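/- arXiv:1811.06566 — 5 statements merged into one kernel-verified Lean document; each statement's English description precedes it below -/
import Mathlib

section
/- For every irreducible complex character χ of W, the value χ(R) := Σ_{t ∈ R} χ(t) is a rational integer, and it satisfies −|A|·χ(1) ≤ χ(R) ≤ |R|·χ(1). -/
open scoped BigOperators

noncomputable section

/-- `χ` is an irreducible complex character of the group `G`. -/
def IsIrredChar (G : Type*) [Group G] (χ : G → ℂ) : Prop :=
  ∃ (n : ℕ) (ρ : Representation ℂ G (Fin n → ℂ)),
    0 < n ∧
    (∀ U : Submodule ℂ (Fin n → ℂ), (∀ g : G, U.map (ρ g) ≤ U) → U = ⊥ ∨ U = ⊤) ∧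
    ∀ g : G, χ g = LinearMap.trace ℂ (Fin n → ℂ) (ρ g)

variable {V : Type*} [AddCommGroup V] [Module ℂ V]

/-- The fixed space `ker (w - id)` of an invertible linear map `w`. -/
def fixedSpace (w : (V →ₗ[ℂ] V)ˣ) : Submodule ℂ V :=
  LinearMap.ker ((w : V →ₗ[ℂ] V) - LinearMap.id)

/-- `w` is a reflection: its fixed space is a hyperplane (codimension 1). -/
def IsReflection (w : (V →ₗ[ℂ] V)ˣ) : Prop :=
  Module.finrank ℂ V = Module.finrank ℂ (fixedSpace w) + 1

/-- The linear map underlying an element of `W`. -/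
def toLin (W : Subgroup (V →ₗ[ℂ] V)ˣ) (w : W) : V →ₗ[ℂ] V :=
  ((w : (V →ₗ[ℂ] V)ˣ) : V →ₗ[ℂ] V)

/-- The set of reflections of `W`. -/
def refls (W : Subgroup (V →ₗ[ℂ] V)ˣ) : Set W :=
  {t | IsReflection (t : (V →ₗ[ℂ] V)ˣ)}

/-- The arrangement of reflecting hyperplanes of `W`. -/
def arrangement (W : Subgroup (V →ₗ[ℂ] V)ˣ) : Set (Submodule ℂ V) :=
  {H | ∃ t : W, t ∈ refls W ∧ H = fixedSpace (t : (V →ₗ[ℂ] V)ˣ)}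

/-- The pointwise stabilizer of a subspace `H` in `W`. -/
def ptStab (W : Subgroup (V →ₗ[ℂ] V)ˣ) (H : Submodule ℂ V) : Set W :=
  {w | ∀ v ∈ H, toLin W w v = v}

/-- The `W`-orbit of a hyperplane `H`. -/
def orbitOf (W : Subgroup (V →ₗ[ℂ] V)ˣ) (H : Submodule ℂ V) : Set (Submodule ℂ V) :=
  {H' | ∃ w : W, H' = H.map (toLin W w)}

/-- The reflections of `W` whose hyperplane lies in the orbit of `H`. -/
def Cref (W : Subgroup (V →ₗ[ℂ] V)ˣ) (H : Submodule ℂ V) : Set W :=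
  {t | t ∈ refls W ∧ fixedSpace (t : (V →ₗ[ℂ] V)ˣ) ∈ orbitOf W H}

/-- `g ∈ W` is a regular element of order `d`: it has a nonzero eigenvector,
with eigenvalue a primitive `d`-th root of unity, lying on no reflecting hyperplane. -/
def IsRegularElt (W : Subgroup (V →ₗ[ℂ] V)ˣ) (g : W) (d : ℕ) : Prop :=
  orderOf g = d ∧ ∃ (ζ : ℂ) (v : V), v ≠ 0 ∧ IsPrimitiveRoot ζ d ∧
    toLin W g v = ζ • v ∧ ∀ H ∈ arrangement W, v ∉ H

/-- The action of `W` on `V` is irreducible. -/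
def IsIrredAction (W : Subgroup (V →ₗ[ℂ] V)ˣ) : Prop :=
  ∀ U : Submodule ℂ V, (∀ w : W, U.map (toLin W w) ≤ U) → U = ⊥ ∨ U = ⊤

/-- `f` is a length-`l` reflection factorization of `g`. -/
def IsReflFac (W : Subgroup (V →ₗ[ℂ] V)ˣ) (g : W) (l : ℕ) (f : Fin l → W) : Prop :=
  (∀ i, f i ∈ refls W) ∧ (List.ofFn f).prod = g

/-- `l` is the reflection length of `g`: the minimal length of a reflection
factorization of `g`. -/
def IsReflLength (W : Subgroup (V →ₗ[ℂ] V)ˣ) (g : W) (l : ℕ) : Prop :=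
  (∃ f : Fin l → W, IsReflFac W g l f) ∧
    ∀ (k : ℕ) (f : Fin k → W), IsReflFac W g k f → l ≤ k

open Classical in
/-- `n` is the minimal number of factors whose hyperplane lies in the orbit `C`,
over all reflection factorizations of `g` (of any length). -/
def IsMinOrbitCount (W : Subgroup (V →ₗ[ℂ] V)ˣ) (g : W)
    (C : Set (Submodule ℂ V)) (n : ℕ) : Prop :=
  (∃ (N : ℕ) (f : Fin N → W), IsReflFac W g N f ∧
      (Finset.univ.filter fun i => fixedSpace (f i : (V →ₗ[ℂ] V)ˣ) ∈ C).card = n) ∧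
  ∀ (N : ℕ) (f : Fin N → W), IsReflFac W g N f →
      n ≤ (Finset.univ.filter fun i => fixedSpace (f i : (V →ₗ[ℂ] V)ˣ) ∈ C).card

/-- The sum of a character over a finite group is `|G|` times the dimension of the invariants. -/
theorem sum_trace_eq_card_mul_finrank {G : Type*} [Group G] [Fintype G] {n : ℕ}
    (ρ : Representation ℂ G (Fin n → ℂ)) :
    ∑ g : G, LinearMap.trace ℂ (Fin n → ℂ) (ρ g) =
      (Fintype.card G : ℂ) * (Module.finrank ℂ ρ.invariants : ℂ) := by
  have hne : (Fintype.card G : ℂ) ≠ 0 := by exact_mod_cast Fintype.card_ne_zero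
  letI : Invertible (Fintype.card G : ℂ) := invertibleOfNonzero hne
  rw [← (Representation.isProj_averageMap ρ).trace]
  simp [Representation.averageMap, GroupAlgebra.average, map_sum, hne]

/-- The pointwise stabilizer as a subgroup. -/
def stabSubgroup (W : Subgroup (V →ₗ[ℂ] V)ˣ) (H : Submodule ℂ V) : Subgroup W where
  carrier := ptStab W H
  one_mem' := by
    intro v _
    simp [toLin]
  mul_mem' := by
    intro a b ha hb v hv
    have h1 := ha v hv
    have h2 := hb v hv
    simp only [toLin] at h1 h2 ⊢
    simp [h1, h2]
  inv_mem' := by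
    intro a ha v hv
    have h1 := ha v hv
    simp only [toLin] at h1 ⊢
    have h3 : (((a⁻¹ : W) : (V →ₗ[ℂ] V)ˣ) : V →ₗ[ℂ] V) *
        (((a : W) : (V →ₗ[ℂ] V)ˣ) : V →ₗ[ℂ] V) = 1 := by simp
    have h4 := congrArg (fun f : V →ₗ[ℂ] V => f v) h3
    simpa only [Module.End.mul_apply, h1, Module.End.one_apply] using h4

/-- The non-identity elements fixing a reflecting hyperplane `H` pointwise are exactly the
reflections with hyperplane `H`. -/
theorem mem_stab_iff [FiniteDimensional ℂ V] (W : Subgroup (V →ₗ[ℂ] V)ˣ) (H : Submodule ℂ V)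
    (hH : Module.finrank ℂ V = Module.finrank ℂ H + 1) (t : W) :
    (t ∈ refls W ∧ fixedSpace (t : (V →ₗ[ℂ] V)ˣ) = H) ↔ (t ∈ stabSubgroup W H ∧ t ≠ 1) := by
  have hmem : t ∈ stabSubgroup W H ↔ H ≤ fixedSpace (t : (V →ₗ[ℂ] V)ˣ) := by
    constructor
    · intro h v hv
      have := h v hv
      simpa [fixedSpace, sub_eq_zero, toLin] using this
    · intro h v hv
      have := h hv
      simpa [fixedSpace, sub_eq_zero, toLin] using this
  have htop : fixedSpace (t : (V →ₗ[ℂ] V)ˣ) = ⊤ ↔ t = 1 := by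
    constructor
    · intro h
      apply Subtype.ext
      apply Units.ext
      have h' := LinearMap.ker_eq_top.mp h
      rw [sub_eq_zero] at h'
      exact h'
    · rintro rfl
      apply LinearMap.ker_eq_top.mpr
      rw [sub_eq_zero]
      rfl
  rw [hmem]
  constructor
  · rintro ⟨h1, h2⟩
    refine ⟨h2.ge, fun h => ?_⟩
    have h3 := htop.mpr h
    rw [h2] at h3
    rw [h3, finrank_top] at hH
    omega
  · rintro ⟨h1, h2⟩
    have hlt : Module.finrank ℂ (fixedSpace (t : (V →ₗ[ℂ] V)ˣ)) < Module.finrank ℂ V :=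
      Submodule.finrank_lt (fun h => h2 (htop.mp h))
    have hle := Submodule.finrank_mono h1
    have heq : H = fixedSpace (t : (V →ₗ[ℂ] V)ˣ) :=
      Submodule.eq_of_le_of_finrank_eq h1 (by omega)
    refine ⟨?_, heq.symm⟩
    change Module.finrank ℂ V = _
    rw [← heq]
    exact hH

open Classical in
/-- Contribution of a single hyperplane. -/
theorem fiber_sum [FiniteDimensional ℂ V] (W : Subgroup (V →ₗ[ℂ] V)ˣ) [Fintype W] {n : ℕ}
    (ρ : Representation ℂ W (Fin n → ℂ)) (H : Submodule ℂ V)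
    (hH : Module.finrank ℂ V = Module.finrank ℂ H + 1) :
    ∃ m : ℤ, ∑ t ∈ (refls W).toFinset.filter (fun t : W => fixedSpace (t : (V →ₗ[ℂ] V)ˣ) = H),
        LinearMap.trace ℂ (Fin n → ℂ) (ρ t) = (m : ℂ) ∧ -(n : ℤ) ≤ m ∧
      m ≤ (((refls W).toFinset.filter
        (fun t : W => fixedSpace (t : (V →ₗ[ℂ] V)ˣ) = H)).card : ℤ) * n := by
  have hset : (refls W).toFinset.filter (fun t : W => fixedSpace (t : (V →ₗ[ℂ] V)ˣ) = H) =
      (Finset.univ.filter (fun t => t ∈ stabSubgroup W H)).erase 1 := by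
    ext t
    have := mem_stab_iff W H hH t
    simp only [Finset.mem_filter, Set.mem_toFinset, Finset.mem_erase, Finset.mem_univ, true_and]
    tauto
  have h1 : (1 : W) ∈ Finset.univ.filter (fun t => t ∈ stabSubgroup W H) := by
    simp [one_mem]
  have hsum := sum_trace_eq_card_mul_finrank (ρ.comp (stabSubgroup W H).subtype)
  set d := Module.finrank ℂ (Representation.invariants (ρ.comp (stabSubgroup W H).subtype))
    with hd
  have hdn : d ≤ n := by
    have := Submodule.finrank_le
      (Representation.invariants (ρ.comp (stabSubgroup W H).subtype))
    simpa using this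
  have hcard : (Finset.univ.filter (fun t => t ∈ stabSubgroup W H)).card =
      Fintype.card (stabSubgroup W H) := by
    rw [Fintype.card_subtype]
  have hsum2 : ∑ t ∈ Finset.univ.filter (fun t => t ∈ stabSubgroup W H),
      LinearMap.trace ℂ (Fin n → ℂ) (ρ t) = (Fintype.card (stabSubgroup W H) : ℂ) * d := by
    rw [← hsum]
    exact Finset.sum_subtype _ (by simp) _
  have hpos : 0 < Fintype.card (stabSubgroup W H) := Fintype.card_pos
  have htr1 : LinearMap.trace ℂ (Fin n → ℂ) (ρ 1) = n := by simp
  rw [hset]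
  refine ⟨(Fintype.card (stabSubgroup W H) : ℤ) * d - n, ?_, ?_, ?_⟩
  · rw [← Finset.add_sum_erase _ _ h1, htr1] at hsum2
    push_cast
    rw [← hsum2]
    ring
  · have : (0 : ℤ) ≤ (Fintype.card (stabSubgroup W H) : ℤ) * d := by positivity
    linarith
  · rw [Finset.card_erase_of_mem h1, hcard, Nat.cast_sub hpos]
    have : (Fintype.card (stabSubgroup W H) : ℤ) * d ≤
      (Fintype.card (stabSubgroup W H) : ℤ) * n := by gcongr
    push_cast
    linarith

open ComplexOrder in
/-- For an irreducible complex character `χ` of a finite complex reflection group `W`,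
the value `χ(R) = Σ_{t ∈ R} χ(t)` is a rational integer and satisfies
`−|A|·χ(1) ≤ χ(R) ≤ |R|·χ(1)`. -/
theorem char_sum_over_reflections_is_integer_and_bounded
    (V : Type*) [AddCommGroup V] [Module ℂ V] [FiniteDimensional ℂ V]
    (W : Subgroup (V →ₗ[ℂ] V)ˣ) [Finite W]
    (hgen : Subgroup.closure (refls W) = ⊤)
    (χ : W → ℂ) (hχ : IsIrredChar W χ) :
    (∃ m : ℤ, ∑ᶠ t ∈ refls W, χ t = (m : ℂ)) ∧
      -(((arrangement W).ncard : ℂ) * χ 1) ≤ ∑ᶠ t ∈ refls W, χ t ∧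
      ∑ᶠ t ∈ refls W, χ t ≤ (((refls W).ncard : ℂ)) * χ 1 := by
  classical
  obtain ⟨n, ρ, -, -, hρ⟩ := hχ
  haveI : Fintype W := Fintype.ofFinite W
  have hχ1 : χ 1 = n := by rw [hρ]; simp
  set f : W → Submodule ℂ V := fun t => fixedSpace (t : (V →ₗ[ℂ] V)ˣ) with hf
  set A : Finset (Submodule ℂ V) := (refls W).toFinset.image f with hA
  have harr : arrangement W = (A : Set (Submodule ℂ V)) := by
    ext H
    simp only [arrangement, hA, hf, Finset.coe_image, Set.coe_toFinset, Set.mem_image,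
      Set.mem_ofPred_eq]
    constructor
    · rintro ⟨t, h1, h2⟩
      exact ⟨t, h1, h2.symm⟩
    · rintro ⟨t, h1, h2⟩
      exact ⟨t, h1, h2.symm⟩
  have hfin : ∑ᶠ t ∈ refls W, χ t = ∑ t ∈ (refls W).toFinset, χ t :=
    finsum_mem_eq_toFinset_sum _ _
  have hmaps : ∀ t ∈ (refls W).toFinset, f t ∈ A := fun t ht => Finset.mem_image_of_mem f ht
  have hex : ∀ H : Submodule ℂ V, ∃ m : ℤ, H ∈ A →
      (∑ t ∈ (refls W).toFinset with f t = H, χ t = (m : ℂ) ∧ -(n : ℤ) ≤ m ∧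
      m ≤ (((refls W).toFinset.filter (fun t => f t = H)).card : ℤ) * n) := by
    intro H
    by_cases hHA : H ∈ A
    · obtain ⟨t, ht, rfl⟩ := Finset.mem_image.mp hHA
      have ht' : t ∈ refls W := Set.mem_toFinset.mp ht
      obtain ⟨m, hm⟩ := fiber_sum W ρ (f t) ht'
      refine ⟨m, fun _ => ?_⟩
      simp only [hρ]
      exact hm
    · exact ⟨0, fun h => absurd h hHA⟩
  choose m hm using hex
  have htot : ∑ t ∈ (refls W).toFinset, χ t = ((∑ H ∈ A, m H : ℤ) : ℂ) := by
    rw [← Finset.sum_fiberwise_of_maps_to hmaps]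
    push_cast
    exact Finset.sum_congr rfl fun H hH => (hm H hH).1
  have hlow : -((A.card : ℤ) * n) ≤ ∑ H ∈ A, m H := by
    have := Finset.card_nsmul_le_sum A m (-(n : ℤ)) (fun H hH => (hm H hH).2.1)
    simpa using this
  have hup : ∑ H ∈ A, m H ≤ ((refls W).toFinset.card : ℤ) * n := by
    rw [Finset.card_eq_sum_card_fiberwise hmaps]
    push_cast
    rw [Finset.sum_mul]
    exact Finset.sum_le_sum fun H hH => (hm H hH).2.2
  have hcastle : ∀ a b : ℤ, a ≤ b → (a : ℂ) ≤ (b : ℂ) := fun a b h => by exact_mod_cast h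
  rw [hfin, htot, harr, Set.ncard_coe_finset, Set.ncard_eq_toFinset_card', hχ1]
  refine ⟨⟨_, rfl⟩, ?_, ?_⟩
  · have := hcastle _ _ hlow
    push_cast at this ⊢
    exact this
  · have := hcastle _ _ hup
    push_cast at this ⊢
    exact this
end
end

section
/- If d is a regular number of W, then for every W-orbit C of reflecting hyperplanes, d divides e_C · ω_C. -/
open scoped BigOperators

noncomputable section

variable {V : Type*} [AddCommGroup V] [Module ℂ V]

/-- Two linear forms with the same kernel are proportional. -/
theorem exists_smul_of_ker_le {V : Type*} [AddCommGroup V] [Module ℂ V]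
    (φ ψ : V →ₗ[ℂ] ℂ) (h : LinearMap.ker ψ ≤ LinearMap.ker φ) : ∃ c : ℂ, ∀ x, φ x = c * ψ x := by
  have h1 := mem_span_of_iInf_ker_le_ker (ι := Unit) (L := fun _ => ψ) (K := φ) (by simpa using h)
  have h2 : φ ∈ Submodule.span ℂ {ψ} := by simpa using h1
  obtain ⟨c, hc⟩ := Submodule.mem_span_singleton.1 h2
  exact ⟨c, fun x => by rw [← hc]; simp⟩

/-- A hyperplane is the kernel of a linear form. -/
theorem exists_form {V : Type*} [AddCommGroup V] [Module ℂ V] [FiniteDimensional ℂ V]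
    (H : Submodule ℂ V) (h : Module.finrank ℂ V = Module.finrank ℂ H + 1) :
    ∃ φ : V →ₗ[ℂ] ℂ, LinearMap.ker φ = H := by
  have hlt : H < ⊤ := by
    rw [lt_top_iff_ne_top]
    rintro rfl
    simp at h
  obtain ⟨φ, h0, hle⟩ := H.exists_le_ker_of_lt_top hlt
  refine ⟨φ, (Submodule.eq_of_le_of_finrank_le hle ?_).symm⟩
  have h1 := LinearMap.finrank_range_add_finrank_ker φ
  have h2 : 0 < Module.finrank ℂ (LinearMap.range φ) := by
    rw [Nat.pos_iff_ne_zero, Ne, Submodule.finrank_eq_zero, LinearMap.range_eq_bot]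
    exact h0
  omega

/-- The product of linear forms of a stable set of hyperplanes is invariant under a map
that fixes a point lying on none of them. -/
theorem prod_invariant {V : Type*} [AddCommGroup V] [Module ℂ V]
    (S : Finset (Submodule ℂ V)) (α : Submodule ℂ V → (V →ₗ[ℂ] ℂ))
    (hα : ∀ H ∈ S, LinearMap.ker (α H) = H) (w : V →ₗ[ℂ] V) (hw : Function.Surjective w)
    (hS : ∀ H ∈ S, H.comap w ∈ S) (v : V) (hv : w v = v) (hvS : ∀ H ∈ S, v ∉ H) (x : V) :
    ∏ H ∈ S, α H (w x) = ∏ H ∈ S, α H x := by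
  classical
  have hinj : Function.Injective (Submodule.comap w) := Submodule.comap_injective_of_surjective hw
  have himg : S.image (Submodule.comap w) = S := by
    apply Finset.eq_of_subset_of_card_le
    · intro H hH
      obtain ⟨K, hK, rfl⟩ := Finset.mem_image.1 hH
      exact hS K hK
    · rw [Finset.card_image_of_injective _ hinj]
  have hc : ∀ H, ∃ c : ℂ, H ∈ S → ∀ x, α H (w x) = c * α (H.comap w) x := by
    intro H
    by_cases hH : H ∈ S
    · obtain ⟨c, hc⟩ := exists_smul_of_ker_le (α H ∘ₗ w) (α (H.comap w)) (by
        rw [hα _ (hS H hH), LinearMap.ker_comp, hα H hH])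
      exact ⟨c, fun _ => hc⟩
    · exact ⟨0, fun h => absurd h hH⟩
  choose c hc using hc
  have key : ∀ x, ∏ H ∈ S, α H (w x) = (∏ H ∈ S, c H) * ∏ H ∈ S, α H x := by
    intro x
    rw [Finset.prod_congr rfl (fun H hH => hc H hH x), Finset.prod_mul_distrib]
    congr 1
    conv_rhs => rw [← himg]
    rw [Finset.prod_image (fun _ _ _ _ h => hinj h)]
  have h1 := key v
  rw [hv] at h1
  have hne : ∏ H ∈ S, α H v ≠ 0 := by
    rw [Finset.prod_ne_zero_iff]
    intro H hH h0
    apply hvS H hH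
    rw [← hα H hH]
    exact h0
  have h2 : ∏ H ∈ S, c H = 1 := by
    apply mul_right_cancel₀ hne
    rw [← h1, one_mul]
  rw [key, h2, one_mul]

/-- A subspace has a point avoiding finitely many subspaces not containing it. -/
theorem exists_generic {V : Type*} [AddCommGroup V] [Module ℂ V]
    (K : Submodule ℂ V) (S : Finset (Submodule ℂ V)) (h : ∀ H ∈ S, ¬ K ≤ H) :
    ∃ v ∈ K, ∀ H ∈ S, v ∉ H := by
  classical
  have h1 := Subspace.biUnion_ne_univ_of_top_notMem (k := ℂ) (E := K)
    (s := S.image (fun H => H.comap K.subtype)) (by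
      intro hm
      obtain ⟨H, hH, he⟩ := Finset.mem_image.1 hm
      apply h H hH
      exact Submodule.comap_subtype_eq_top.1 he)
  obtain ⟨v, hv⟩ := (Set.ne_univ_iff_exists_notMem _).1 h1
  refine ⟨v, v.2, fun H hH hvH => hv ?_⟩
  simp only [Set.mem_iUnion]
  exact ⟨_, Finset.mem_image_of_mem _ hH, hvH⟩

theorem toLin_mul_apply {V : Type*} [AddCommGroup V] [Module ℂ V]
    (W : Subgroup (V →ₗ[ℂ] V)ˣ) (a b : W) (x : V) :
    toLin W (a * b) x = toLin W a (toLin W b x) := rfl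

theorem toLin_one_apply {V : Type*} [AddCommGroup V] [Module ℂ V]
    (W : Subgroup (V →ₗ[ℂ] V)ˣ) (x : V) : toLin W 1 x = x := rfl

theorem toLin_inv_apply {V : Type*} [AddCommGroup V] [Module ℂ V]
    (W : Subgroup (V →ₗ[ℂ] V)ˣ) (a : W) (x : V) : toLin W a⁻¹ (toLin W a x) = x := by
  rw [← toLin_mul_apply, inv_mul_cancel, toLin_one_apply]

theorem toLin_apply_inv {V : Type*} [AddCommGroup V] [Module ℂ V]
    (W : Subgroup (V →ₗ[ℂ] V)ˣ) (a : W) (x : V) : toLin W a (toLin W a⁻¹ x) = x := by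
  rw [← toLin_mul_apply, mul_inv_cancel, toLin_one_apply]

theorem mem_fixedSpace_iff {V : Type*} [AddCommGroup V] [Module ℂ V]
    (W : Subgroup (V →ₗ[ℂ] V)ˣ) (a : W) (x : V) :
    x ∈ fixedSpace (a : (V →ₗ[ℂ] V)ˣ) ↔ toLin W a x = x := by
  simp [fixedSpace, toLin, sub_eq_zero]

theorem mem_map_toLin {V : Type*} [AddCommGroup V] [Module ℂ V]
    (W : Subgroup (V →ₗ[ℂ] V)ˣ) (a : W) (H : Submodule ℂ V) (x : V) :
    x ∈ H.map (toLin W a) ↔ toLin W a⁻¹ x ∈ H := by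
  constructor
  · rintro ⟨y, hy, rfl⟩
    rw [toLin_inv_apply]
    exact hy
  · intro h
    exact ⟨_, h, toLin_apply_inv W a x⟩

/-- The pointwise stabilizer as a subgroup. -/
def ptStabSubgroup {V : Type*} [AddCommGroup V] [Module ℂ V]
    (W : Subgroup (V →ₗ[ℂ] V)ˣ) (H : Submodule ℂ V) : Subgroup W where
  carrier := ptStab W H
  one_mem' := fun _ _ => rfl
  mul_mem' := by
    intro a b ha hb v hv
    rw [toLin_mul_apply, hb v hv, ha v hv]
  inv_mem' := by
    intro a ha v hv
    conv_lhs => rw [← ha v hv]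
    exact toLin_inv_apply W a v

theorem pow_ncard_ptStab {V : Type*} [AddCommGroup V] [Module ℂ V]
    (W : Subgroup (V →ₗ[ℂ] V)ˣ) (H : Submodule ℂ V) (a : W) (ha : a ∈ ptStab W H) :
    a ^ (ptStab W H).ncard = 1 := by
  have h : (⟨a, ha⟩ : ptStabSubgroup W H) ^ Nat.card (ptStabSubgroup W H) = 1 := pow_card_eq_one'
  have h2 := congrArg Subtype.val h
  exact h2

theorem map_mem_arrangement {V : Type*} [AddCommGroup V] [Module ℂ V]
    (W : Subgroup (V →ₗ[ℂ] V)ˣ) (H : Submodule ℂ V) (hH : H ∈ arrangement W) (u : W) :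
    H.map (toLin W u) ∈ arrangement W := by
  obtain ⟨t, ht, rfl⟩ := hH
  have he : (fixedSpace (t : (V →ₗ[ℂ] V)ˣ)).map (toLin W u)
      = fixedSpace ((u * t * u⁻¹ : W) : (V →ₗ[ℂ] V)ˣ) := by
    ext x
    rw [mem_map_toLin, mem_fixedSpace_iff, mem_fixedSpace_iff, toLin_mul_apply, toLin_mul_apply]
    constructor
    · intro h
      rw [h, toLin_apply_inv]
    · intro h
      conv_rhs => rw [← h]
      rw [toLin_inv_apply]
  refine ⟨u * t * u⁻¹, ?_, he⟩
  have hinj : Function.Injective (toLin W u) := fun x y h => by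
    rw [← toLin_inv_apply W u x, h, toLin_inv_apply]
  change _ = _ + 1
  rw [← he, ← (Submodule.equivMapOfInjective _ hinj _).finrank_eq]
  exact ht

/-- If `d` is a regular number of the finite complex reflection group `W`, then for
every reflecting hyperplane `H`, `d` divides `e_C · ω_C`, where `C` is the `W`-orbit
of `H`, `e_C` the order of the pointwise stabilizer and `ω_C` the size of the orbit. -/
theorem regular_number_divides_eC_mul_omegaC
    (V : Type*) [AddCommGroup V] [Module ℂ V] [FiniteDimensional ℂ V]
    (W : Subgroup (V →ₗ[ℂ] V)ˣ) [Finite W]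
    (hgen : Subgroup.closure (refls W) = ⊤)
    (d : ℕ) (g : W) (hg : IsRegularElt W g d)
    (H : Submodule ℂ V) (hH : H ∈ arrangement W) :
    d ∣ (ptStab W H).ncard * (orbitOf W H).ncard := by
  classical
  have hfr : ∀ K ∈ arrangement W, Module.finrank ℂ V = Module.finrank ℂ K + 1 := by
    rintro K ⟨t, ht, rfl⟩
    exact ht
  have hCA : ∀ K ∈ orbitOf W H, K ∈ arrangement W := by
    rintro K ⟨u, rfl⟩
    exact map_mem_arrangement W H hH u
  have hfin : (orbitOf W H).Finite := by
    have : orbitOf W H = Set.range (fun w : W => H.map (toLin W w)) := by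
      ext K
      simp only [orbitOf, Set.mem_setOf_eq, Set.mem_range, eq_comm]
    rw [this]
    exact Set.finite_range _
  have hα : ∀ K : Submodule ℂ V, ∃ φ : V →ₗ[ℂ] ℂ, K ∈ orbitOf W H → LinearMap.ker φ = K := by
    intro K
    by_cases hK : K ∈ orbitOf W H
    · obtain ⟨φ, hφ⟩ := exists_form K (hfr K (hCA K hK))
      exact ⟨φ, fun _ => hφ⟩
    · exact ⟨0, fun h => absurd h hK⟩
  choose α hα using hα
  set C := hfin.toFinset with hC
  have hmemC : ∀ K, K ∈ C ↔ K ∈ orbitOf W H := fun K => hfin.mem_toFinset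
  set e := (ptStab W H).ncard with he
  -- invariance under reflections
  have hrefl : ∀ s ∈ refls W, ∀ x, (∏ K ∈ C, α K (toLin W s x)) ^ e = (∏ K ∈ C, α K x) ^ e := by
    intro s hs x
    set K := fixedSpace (s : (V →ₗ[ℂ] V)ˣ) with hK
    have hKA : K ∈ arrangement W := ⟨s, hs, rfl⟩
    have hsurj : Function.Surjective (toLin W s) := fun y => ⟨_, toLin_apply_inv W s y⟩
    have hKs : K.comap (toLin W s) = K := by
      ext y
      rw [Submodule.mem_comap, mem_fixedSpace_iff, mem_fixedSpace_iff]
      constructor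
      · intro h
        have h2 := congrArg (toLin W s⁻¹) h
        rwa [toLin_inv_apply, toLin_inv_apply] at h2
      · intro h
        rw [h, h]
    have hstable : ∀ L ∈ C.erase K, L.comap (toLin W s) ∈ C.erase K := by
      intro L hL
      rw [Finset.mem_erase] at hL ⊢
      refine ⟨fun h => hL.1 ?_, ?_⟩
      · exact Submodule.comap_injective_of_surjective hsurj (h.trans hKs.symm)
      · obtain ⟨u, rfl⟩ := (hmemC L).1 hL.2
        refine (hmemC _).2 ⟨s⁻¹ * u, ?_⟩
        ext y
        rw [Submodule.mem_comap, mem_map_toLin, mem_map_toLin, mul_inv_rev, inv_inv,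
          toLin_mul_apply]
    obtain ⟨v, hvK, hv⟩ := exists_generic K (C.erase K) (by
      intro L hL hle
      rw [Finset.mem_erase] at hL
      apply hL.1
      refine (Submodule.eq_of_le_of_finrank_eq hle ?_).symm
      have h1 := hfr K hKA
      have h2 := hfr L (hCA L ((hmemC L).1 hL.2))
      omega)
    have hinv := prod_invariant (C.erase K) α
      (fun L hL => hα L ((hmemC L).1 (Finset.mem_of_mem_erase hL))) (toLin W s) hsurj hstable v
      ((mem_fixedSpace_iff W s v).1 hvK) hv x
    by_cases hKC : K ∈ C
    · rw [← Finset.mul_prod_erase C _ hKC, ← Finset.mul_prod_erase C _ hKC, hinv, mul_pow, mul_pow]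
      congr 1
      obtain ⟨u, hu⟩ := (hmemC K).1 hKC
      have hst : u⁻¹ * s * u ∈ ptStab W H := by
        intro y hy
        have h1 : toLin W u y ∈ K := by
          rw [hu]
          exact ⟨y, hy, rfl⟩
        rw [toLin_mul_apply, toLin_mul_apply, (mem_fixedSpace_iff W s _).1 h1, toLin_inv_apply]
      have hpow := pow_ncard_ptStab W H _ hst
      have hse : s ^ e = 1 := by
        have h3 : u⁻¹ * s * u = u⁻¹ * s * (u⁻¹)⁻¹ := by rw [inv_inv]
        rw [h3, conj_pow, inv_inv] at hpow
        have h4 : u⁻¹ * s ^ e = u⁻¹ := by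
          rw [← he] at hpow
          exact mul_eq_one_iff_eq_inv.1 hpow
        exact mul_eq_left.1 h4
      have hker := hα K ((hmemC K).1 hKC)
      obtain ⟨c, hc⟩ := exists_smul_of_ker_le (α K ∘ₗ toLin W s) (α K) (by
        rw [LinearMap.ker_comp, hker, hKs])
      have hc' : ∀ x, α K (toLin W s x) = c * α K x := hc
      have hcn : ∀ n : ℕ, ∀ x, α K (toLin W (s ^ n) x) = c ^ n * α K x := by
        intro n
        induction n with
        | zero => intro x; simp [toLin_one_apply]
        | succ n ih =>
          intro x
          rw [pow_succ, toLin_mul_apply, ih, hc', pow_succ]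
          ring
      have hce : α K x = c ^ e * α K x := by
        rw [← hcn, hse, toLin_one_apply]
      rw [hc', mul_pow]
      by_cases h0 : α K x = 0
      · rw [h0, zero_pow, mul_zero]
        rw [he]
        have : Nonempty (ptStabSubgroup W H) := ⟨1⟩
        exact (Nat.card_pos (α := ptStabSubgroup W H)).ne'
      · have h1 : c ^ e = 1 := (mul_eq_right₀ h0).1 hce.symm
        rw [h1, one_mul]
    · rw [Finset.erase_eq_of_notMem hKC] at hinv
      rw [hinv]
  have hall : ∀ w : W, ∀ x, (∏ K ∈ C, α K (toLin W w x)) ^ e = (∏ K ∈ C, α K x) ^ e := by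
    intro w
    have hw : w ∈ Subgroup.closure (refls W) := by
      rw [hgen]
      exact Subgroup.mem_top w
    induction hw using Subgroup.closure_induction with
    | mem s hs => exact hrefl s hs
    | one => intro x; rw [toLin_one_apply]
    | mul a b _ _ ha hb => intro x; rw [toLin_mul_apply, ha, hb]
    | inv a _ ha =>
      intro x
      rw [← ha (toLin W a⁻¹ x), toLin_apply_inv]
  obtain ⟨-, ζ, v, -, hζ, hgv, hreg⟩ := hg
  have hne : ∏ K ∈ C, α K v ≠ 0 := by
    rw [Finset.prod_ne_zero_iff]
    intro K hK h0
    have hK' := (hmemC K).1 hK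
    apply hreg K (hCA K hK')
    rw [← hα K hK']
    exact h0
  have h1 := hall g v
  rw [hgv] at h1
  simp only [map_smul, smul_eq_mul, Finset.prod_mul_distrib, Finset.prod_const] at h1
  rw [mul_pow, ← pow_mul] at h1
  have h2 := (mul_eq_right₀ (pow_ne_zero e hne)).1 h1
  have h3 := hζ.dvd_of_pow_eq_one _ h2
  rw [Set.ncard_eq_toFinset_card _ hfin, mul_comm]
  exact h3
end
end

section
/- Let χ be an irreducible complex character of W afforded by a representation ρ on a space U, let C be a W-orbit of reflecting hyperplanes, let H ∈ C, and let m be the dimension of the subspace {u ∈ U : ρ(w)u = u for all w ∈ W_H} (equivalently, the multiplicity of 1 as an eigenvalue of ρ(t) for any generator t of the cyclic group W_H). Then the local Coxeter number satisfies c_{χ,C} = e_C · ω_C · (1 − m/χ(1)), i.e. χ(1)·c_{χ,C} = e_C·ω_C·(χ(1) − m). -/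
open scoped BigOperators

noncomputable section

variable {V : Type*} [AddCommGroup V] [Module ℂ V]

/-- The pointwise stabilizer as a subgroup. -/
def ptStabSub (W : Subgroup (V →ₗ[ℂ] V)ˣ) (H : Submodule ℂ V) : Subgroup W where
  carrier := ptStab W H
  one_mem' := by intro v _; simp [toLin]
  mul_mem' := by
    intro a b ha hb v hv
    have h1 := ha v hv
    have h2 := hb v hv
    simp only [toLin] at *
    simp [h1, h2]
  inv_mem' := by
    intro a ha v hv
    have h1 := ha v hv
    simp only [toLin] at *
    have h3 : ((a : (V →ₗ[ℂ] V)ˣ)⁻¹ * (a : (V →ₗ[ℂ] V)ˣ) : (V →ₗ[ℂ] V)ˣ) = 1 := by simp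
    have h4 := congrArg (fun u : (V →ₗ[ℂ] V)ˣ => (u : V →ₗ[ℂ] V) v) h3
    simp only [Units.val_mul, Module.End.mul_apply, h1] at h4
    simpa using h4

lemma toLin_mul (W : Subgroup (V →ₗ[ℂ] V)ˣ) (a b : W) (v : V) :
    toLin W (a * b) v = toLin W a (toLin W b v) := by
  simp [toLin]

lemma toLin_inv_self (W : Subgroup (V →ₗ[ℂ] V)ˣ) (a : W) (v : V) :
    toLin W a⁻¹ (toLin W a v) = v := by
  rw [← toLin_mul]; simp [toLin]

lemma toLin_self_inv (W : Subgroup (V →ₗ[ℂ] V)ˣ) (a : W) (v : V) :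
    toLin W a (toLin W a⁻¹ v) = v := by
  rw [← toLin_mul]; simp [toLin]

lemma mem_ptStab_conj (W : Subgroup (V →ₗ[ℂ] V)ˣ) (H : Submodule ℂ V) (g w : W) :
    g * w * g⁻¹ ∈ ptStab W (H.map (toLin W g)) ↔ w ∈ ptStab W H := by
  constructor
  · intro h v hv
    have := h (toLin W g v) (Submodule.mem_map_of_mem hv)
    rw [toLin_mul, toLin_mul, toLin_inv_self] at this
    rw [← toLin_inv_self W g (toLin W w v), this, toLin_inv_self]
  · rintro h _ ⟨v, hv, rfl⟩
    rw [toLin_mul, toLin_mul, toLin_inv_self, h v hv]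

lemma mem_refl_iff [FiniteDimensional ℂ V] (W : Subgroup (V →ₗ[ℂ] V)ˣ) (H : Submodule ℂ V)
    (hH : Module.finrank ℂ V = Module.finrank ℂ H + 1) (t : W) (ht : t ≠ 1) :
    (t ∈ refls W ∧ fixedSpace (t : (V →ₗ[ℂ] V)ˣ) = H) ↔ t ∈ ptStab W H := by
  have hle : t ∈ ptStab W H ↔ H ≤ fixedSpace (t : (V →ₗ[ℂ] V)ˣ) := by
    simp [ptStab, fixedSpace, SetLike.le_def, toLin, sub_eq_zero]
  rw [hle]
  constructor
  · rintro ⟨_, h⟩; exact h.ge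
  · intro h
    have hne : fixedSpace (t : (V →ₗ[ℂ] V)ˣ) ≠ ⊤ := by
      intro h2
      apply ht
      rw [fixedSpace, LinearMap.ker_eq_top, sub_eq_zero] at h2
      exact Subtype.ext (Units.ext h2)
    have h3 := Submodule.finrank_lt hne
    have h4 : H = fixedSpace (t : (V →ₗ[ℂ] V)ˣ) :=
      Submodule.eq_of_le_of_finrank_le h (by omega)
    refine ⟨?_, h4.symm⟩
    show Module.finrank ℂ V = _
    rw [← h4, hH]

lemma sum_ptStab (W : Subgroup (V →ₗ[ℂ] V)ˣ) [Finite W] (n : ℕ)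
    (ρ : Representation ℂ W (Fin n → ℂ)) (χ : W → ℂ)
    (hχ : ∀ w : W, χ w = LinearMap.trace ℂ (Fin n → ℂ) (ρ w)) (H : Submodule ℂ V) :
    ∑ᶠ t ∈ ptStab W H, (χ 1 - χ t) = ((ptStab W H).ncard : ℂ) *
        (χ 1 - (Module.finrank ℂ
          ↥(⨅ w ∈ ptStab W H, LinearMap.ker (ρ w - LinearMap.id)) : ℂ)) := by
  classical
  have : Fintype (ptStabSub W H) := Fintype.ofFinite _
  have hc : ((Fintype.card (ptStabSub W H) : ℕ) : ℂ) ≠ 0 := by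
    exact_mod_cast Fintype.card_ne_zero
  have : Invertible ((Fintype.card (ptStabSub W H) : ℕ) : ℂ) := invertibleOfNonzero hc
  let σ : Representation ℂ (ptStabSub W H) (Fin n → ℂ) := ρ.comp (ptStabSub W H).subtype
  have hinv : (⨅ w ∈ ptStab W H, LinearMap.ker (ρ w - LinearMap.id)) = σ.invariants := by
    ext v
    simp only [Submodule.mem_iInf, LinearMap.mem_ker, LinearMap.sub_apply, LinearMap.id_apply,
      sub_eq_zero, Representation.mem_invariants, Subtype.forall]
    rfl
  have htr := (σ.isProj_averageMap).trace
  have hsum : LinearMap.trace ℂ _ σ.averageMap =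
      ((Fintype.card (ptStabSub W H) : ℕ) : ℂ)⁻¹ * ∑ w : ptStabSub W H, χ w := by
    simp [GroupAlgebra.average, map_sum, hχ, σ]
  have hcard : (ptStab W H).ncard = Fintype.card (ptStabSub W H) := by
    rw [← Nat.card_eq_fintype_card]; rfl
  have hfs : ∑ᶠ t ∈ ptStab W H, (χ 1 - χ t) = ∑ w : ptStabSub W H, (χ 1 - χ w) := by
    rw [← finsum_eq_sum_of_fintype]
    exact (finsum_set_coe_eq_finsum_mem (f := fun t => χ 1 - χ t) (ptStab W H)).symm
  rw [hinv, ← htr, hsum, hcard, hfs, Finset.sum_sub_distrib, mul_sub, mul_inv_cancel_left₀ hc]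
  simp

/-- Local Coxeter number formula: if `χ` is an irreducible character of `W` afforded
by the representation `ρ`, `H` a reflecting hyperplane with orbit `C`, and `m` is
the dimension of the subspace of vectors fixed by the pointwise stabilizer `W_H`,
then `χ(1)·c_{χ,C} = e_C·ω_C·(χ(1) − m)`, where
`χ(1)·c_{χ,C} = Σ_{t ∈ C^ref} (χ(1) − χ(t))`. -/
theorem local_coxeter_number_formula
    (V : Type*) [AddCommGroup V] [Module ℂ V] [FiniteDimensional ℂ V]
    (W : Subgroup (V →ₗ[ℂ] V)ˣ) [Finite W]
    (hgen : Subgroup.closure (refls W) = ⊤)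
    (n : ℕ) (hn : 0 < n) (ρ : Representation ℂ W (Fin n → ℂ))
    (hρ : ∀ U : Submodule ℂ (Fin n → ℂ), (∀ w : W, U.map (ρ w) ≤ U) → U = ⊥ ∨ U = ⊤)
    (χ : W → ℂ) (hχ : ∀ w : W, χ w = LinearMap.trace ℂ (Fin n → ℂ) (ρ w))
    (H : Submodule ℂ V) (hH : H ∈ arrangement W) :
    ∑ᶠ t ∈ Cref W H, (χ 1 - χ t) =
      (((ptStab W H).ncard * (orbitOf W H).ncard : ℕ) : ℂ) *
        (χ 1 - (Module.finrank ℂ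
          ↥(⨅ w ∈ ptStab W H, LinearMap.ker (ρ w - LinearMap.id)) : ℂ)) := by
  classical
  obtain ⟨t₀, ht₀, rfl⟩ := hH
  set H := fixedSpace (t₀ : (V →ₗ[ℂ] V)ˣ) with hHdef
  have hdim : Module.finrank ℂ V = Module.finrank ℂ H + 1 := ht₀
  have hfin : (orbitOf W H).Finite := by
    have : orbitOf W H = Set.range (fun w : W => H.map (toLin W w)) := by
      ext K; simp [orbitOf, eq_comm]
    rw [this]; exact Set.finite_range _
  have hU : Cref W H = ⋃ K ∈ orbitOf W H,
      {t : W | t ∈ refls W ∧ fixedSpace (t : (V →ₗ[ℂ] V)ˣ) = K} := by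
    ext t; simp [Cref, and_comm]
  have hdisj : (orbitOf W H).PairwiseDisjoint
      (fun K => {t : W | t ∈ refls W ∧ fixedSpace (t : (V →ₗ[ℂ] V)ˣ) = K}) := by
    intro K _ L _ hKL
    rw [Function.onFun, Set.disjoint_left]
    rintro t ⟨_, h1⟩ ⟨_, h2⟩
    exact hKL (h1.symm.trans h2)
  rw [hU, finsum_mem_biUnion hdisj hfin (fun _ _ => Set.toFinite _)]
  have key : ∀ K ∈ orbitOf W H,
      ∑ᶠ t ∈ {t : W | t ∈ refls W ∧ fixedSpace (t : (V →ₗ[ℂ] V)ˣ) = K}, (χ 1 - χ t) =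
      ∑ᶠ t ∈ ptStab W H, (χ 1 - χ t) := by
    rintro _ ⟨g, rfl⟩
    have hinj : Function.Injective (toLin W g) :=
      Function.LeftInverse.injective (toLin_inv_self W g)
    have hd : Module.finrank ℂ V = Module.finrank ℂ (H.map (toLin W g)) + 1 := by
      rw [hdim, (Submodule.equivMapOfInjective _ hinj H).finrank_eq]
    rw [finsum_mem_inter_support_eq' _ _ (ptStab W (H.map (toLin W g)))]
    · symm
      refine finsum_mem_eq_of_bijOn (fun t => g * t * g⁻¹) ⟨?_, ?_, ?_⟩ ?_
      · intro t ht; exact (mem_ptStab_conj W H g t).2 ht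
      · intro a _ b _ hab; simpa using hab
      · intro t ht
        refine ⟨g⁻¹ * t * g, ?_, by group⟩
        rw [← mem_ptStab_conj W H g]
        convert ht using 1
        group
      · intro t _
        have : χ (g * t * g⁻¹) = χ t := by
          rw [hχ, hχ, map_mul, LinearMap.trace_mul_comm, ← map_mul]
          congr 2; group
        rw [this]
    · intro t ht
      refine mem_refl_iff W _ hd t ?_
      rintro rfl
      simp at ht
  rw [finsum_mem_congr rfl key, sum_ptStab W n ρ χ hχ H,
    finsum_mem_eq_finite_toFinset_sum _ hfin, Finset.sum_const,
    ← Set.ncard_eq_toFinset_card _ hfin]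
  rw [nsmul_eq_mul]; push_cast; ring
end
end

section
/- Let χ be an irreducible complex character of W afforded by a representation ρ. For each W-orbit C of reflecting hyperplanes fix H_C ∈ C, let s_{H_C} be the distinguished reflection generating W_{H_C} (the generator with determinant exp(2πi/e_C)), and let m^χ_{C,j} be the multiplicity of exp(2πij/e_C) as an eigenvalue of ρ(s_{H_C}), for 0 ≤ j ≤ e_C − 1. Set N(χ) := Σ_C ω_C · Σ_{j=0}^{e_C−1} j·m^χ_{C,j}, and let χ* be the complex-conjugate (dual) character. Then χ(1)·c_χ = N(χ) + N(χ*). -/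
open scoped BigOperators

noncomputable section

variable {V : Type*} [AddCommGroup V] [Module ℂ V]

lemma eig_formula {n : ℕ} (e : ℕ) (he : 0 < e) (A : (Fin n → ℂ) →ₗ[ℂ] (Fin n → ℂ))
    (hA : A ^ e = 1) (z : ℂ) (hz : z ^ e = 1) :
    (e : ℂ) * Module.finrank ℂ (Module.End.eigenspace A z) =
      ∑ k ∈ Finset.range e, z⁻¹ ^ k * LinearMap.trace ℂ (Fin n → ℂ) (A ^ k) := by
  have he0 : (e : ℂ) ≠ 0 := by exact_mod_cast he.ne'
  have hz0 : z ≠ 0 := by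
    rintro rfl
    rw [zero_pow he.ne'] at hz
    exact zero_ne_one hz
  set S : (Fin n → ℂ) →ₗ[ℂ] (Fin n → ℂ) := ∑ k ∈ Finset.range e, z⁻¹ ^ k • A ^ k with hS
  have hAS : A * S = z • S := by
    have h1 : (z⁻¹ • A) * S = S := by
      have h2 : S = ∑ k ∈ Finset.range e, (z⁻¹ • A) ^ k := by
        rw [hS]
        exact Finset.sum_congr rfl fun k _ => (smul_pow _ _ _).symm
      have h3 := mul_geom_sum (z⁻¹ • A) e
      rw [← h2, smul_pow, hA, inv_pow, hz, inv_one, one_smul, sub_self, sub_mul, one_mul,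
        sub_eq_zero] at h3
      exact h3
    rw [smul_mul_assoc] at h1
    calc A * S = z • (z⁻¹ • (A * S)) := by rw [smul_smul, mul_inv_cancel₀ hz0, one_smul]
      _ = z • S := by rw [h1]
  have hP : LinearMap.IsProj (Module.End.eigenspace A z) ((e : ℂ)⁻¹ • S) := by
    constructor
    · intro x
      rw [Module.End.mem_eigenspace_iff]
      have := congrArg (fun f => f x) hAS
      simp only [Module.End.mul_apply, LinearMap.smul_apply] at this
      rw [LinearMap.smul_apply, map_smul, this, smul_comm]
    · intro x hx
      rw [Module.End.mem_eigenspace_iff] at hx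
      have hk : ∀ k : ℕ, (A ^ k) x = z ^ k • x := by
        intro k
        induction k with
        | zero => simp
        | succ k ih => rw [pow_succ', Module.End.mul_apply, ih, map_smul, hx, smul_smul, pow_succ]
      have : S x = (e : ℂ) • x := by
        rw [hS, LinearMap.sum_apply]
        rw [Finset.sum_congr rfl (g := fun _ => x)]
        · rw [Finset.sum_const, Finset.card_range, Nat.cast_smul_eq_nsmul]
        · intro k _
          rw [LinearMap.smul_apply, hk, smul_smul, ← mul_pow, inv_mul_cancel₀ hz0, one_pow, one_smul]
      rw [LinearMap.smul_apply, this, smul_smul, inv_mul_cancel₀ he0, one_smul]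
  have ht := hP.trace
  rw [map_smul, smul_eq_mul] at ht
  rw [← ht, ← mul_assoc, mul_inv_cancel₀ he0, one_mul, hS, map_sum]
  exact Finset.sum_congr rfl fun k _ => by rw [map_smul, smul_eq_mul]

lemma local_formula {n : ℕ} (e : ℕ) (he : 0 < e) (A B : (Fin n → ℂ) →ₗ[ℂ] (Fin n → ℂ))
    (hA : A ^ e = 1) (hB : B ^ e = 1)
    (hAB : ∀ k, LinearMap.trace ℂ (Fin n → ℂ) (B ^ k) =
      (starRingEnd ℂ) (LinearMap.trace ℂ (Fin n → ℂ) (A ^ k))) :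
    ∑ k ∈ Finset.range e, (LinearMap.trace ℂ (Fin n → ℂ) 1 -
        LinearMap.trace ℂ (Fin n → ℂ) (A ^ k)) =
      (∑ j ∈ Finset.range e, (j : ℂ) * Module.finrank ℂ (Module.End.eigenspace A
            (Complex.exp (2 * Real.pi * Complex.I * j / (e : ℂ))))) +
      ∑ j ∈ Finset.range e, (j : ℂ) * Module.finrank ℂ (Module.End.eigenspace B
            (Complex.exp (2 * Real.pi * Complex.I * j / (e : ℂ)))) := by
  have he0 : (e : ℂ) ≠ 0 := by exact_mod_cast he.ne'
  obtain ⟨ζ, hζ⟩ : ∃ ζ, ζ = Complex.exp (2 * Real.pi * Complex.I / (e : ℂ)) := ⟨_, rfl⟩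
  have hprim : IsPrimitiveRoot ζ e := hζ ▸ Complex.isPrimitiveRoot_exp e he.ne'
  have hexp : ∀ j : ℕ, Complex.exp (2 * Real.pi * Complex.I * j / (e : ℂ)) = ζ ^ j := by
    intro j
    rw [hζ, ← Complex.exp_nat_mul]
    congr 1
    ring
  have hz0 : ζ ≠ 0 := hprim.ne_zero he.ne'
  have hpow : ∀ j : ℕ, (ζ ^ j) ^ e = 1 := fun j => by
    rw [← pow_mul, mul_comm, pow_mul, hprim.pow_eq_one, one_pow]
  have hconj : (starRingEnd ℂ) ζ = ζ⁻¹ := by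
    rw [Complex.inv_def]
    have : Complex.normSq ζ = 1 := by
      rw [Complex.normSq_eq_norm_sq, hprim.norm'_eq_one he.ne', one_pow]
    simp [this]
  have hfin : ∀ (j : ℕ) (B : (Fin n → ℂ) →ₗ[ℂ] (Fin n → ℂ)),
      Module.finrank ℂ (Module.End.eigenspace B
        (Complex.exp (2 * Real.pi * Complex.I * j / (e : ℂ)))) =
      Module.finrank ℂ (Module.End.eigenspace B (ζ ^ j)) := fun j B => by rw [hexp]
  simp only [hfin]
  set a : ℕ → ℂ := fun j => (Module.finrank ℂ (Module.End.eigenspace A (ζ ^ j)) : ℂ) with ha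
  set b : ℕ → ℂ := fun j => (Module.finrank ℂ (Module.End.eigenspace B (ζ ^ j)) : ℂ) with hb
  have fa : ∀ j, (e : ℂ) * a j = ∑ k ∈ Finset.range e, (ζ ^ j)⁻¹ ^ k *
      LinearMap.trace ℂ (Fin n → ℂ) (A ^ k) := fun j => eig_formula e he A hA _ (hpow j)
  have fb : ∀ j, (e : ℂ) * b j = ∑ k ∈ Finset.range e, (ζ ^ j)⁻¹ ^ k *
      LinearMap.trace ℂ (Fin n → ℂ) (B ^ k) := fun j => eig_formula e he B hB _ (hpow j)
  have hba : ∀ i j, i + j = e → b i = a j := by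
    intro i j hij
    have hmul : ζ ^ i * ζ ^ j = 1 := by rw [← pow_add, hij, hprim.pow_eq_one]
    have h1 : (starRingEnd ℂ) ((e : ℂ) * a j) = e * a j := by simp [ha]
    apply mul_left_cancel₀ he0
    rw [fb, ← h1, fa, map_sum]
    refine Finset.sum_congr rfl fun k _ => ?_
    have h2 : (starRingEnd ℂ) (ζ ^ j)⁻¹ = (ζ ^ i)⁻¹ := by
      rw [map_inv₀, map_pow, hconj, inv_pow, inv_inv]
      exact eq_inv_of_mul_eq_one_right hmul
    rw [map_mul, hAB, map_pow (starRingEnd ℂ), h2]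
  have hsum : ∑ j ∈ Finset.range e, a j = LinearMap.trace ℂ (Fin n → ℂ) 1 := by
    apply mul_left_cancel₀ he0
    rw [Finset.mul_sum]
    simp only [fa]
    rw [Finset.sum_comm, Finset.sum_eq_single_of_mem 0 (Finset.mem_range.2 he)]
    · simp
    · intro k hk hk0
      rw [← Finset.sum_mul]
      have hp : (ζ⁻¹ ^ k) ^ e = 1 := by
        rw [inv_pow, inv_pow, hpow, inv_one]
      have hne : ζ⁻¹ ^ k ≠ 1 := hprim.inv.pow_ne_one_of_pos_of_lt hk0 (Finset.mem_range.1 hk)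
      have h3 := mul_geom_sum (ζ⁻¹ ^ k) e
      rw [hp, sub_self] at h3
      have h4 := (mul_eq_zero.1 h3).resolve_left (sub_ne_zero.2 hne)
      rw [Finset.sum_congr rfl (g := fun i => (ζ⁻¹ ^ k) ^ i), h4, zero_mul]
      intro j _
      rw [← inv_pow, ← pow_mul, ← pow_mul, mul_comm]
  have h0 : ∑ k ∈ Finset.range e, LinearMap.trace ℂ (Fin n → ℂ) (A ^ k) = e * a 0 := by
    rw [fa]; simp
  rw [Finset.sum_sub_distrib, h0, Finset.sum_const, Finset.card_range, nsmul_eq_mul, ← hsum]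
  change _ = ∑ j ∈ Finset.range e, (j : ℂ) * a j + ∑ j ∈ Finset.range e, (j : ℂ) * b j
  clear_value a b
  obtain ⟨d, rfl⟩ : ∃ d, e = d + 1 := ⟨e - 1, by omega⟩
  rw [Finset.sum_range_succ', Finset.sum_range_succ' (fun j : ℕ => (j : ℂ) * a j),
    Finset.sum_range_succ' (fun j : ℕ => (j : ℂ) * b j),
    ← Finset.sum_range_reflect (fun j : ℕ => ((j + 1 : ℕ) : ℂ) * b (j + 1))]
  simp only [Nat.cast_zero, zero_mul, add_zero]
  rw [← Finset.sum_add_distrib, mul_add, add_sub_cancel_right, Finset.mul_sum]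
  refine Finset.sum_congr rfl fun j hj => ?_
  have hj' := Finset.mem_range.1 hj
  rw [hba (d - 1 - j + 1) (j + 1) (by omega), ← add_mul, ← Nat.cast_add]
  congr 2
  omega

lemma mem_ptStab_iff_le {V : Type*} [AddCommGroup V] [Module ℂ V]
    (W : Subgroup (V →ₗ[ℂ] V)ˣ) (H : Submodule ℂ V) (w : W) :
    w ∈ ptStab W H ↔ H ≤ fixedSpace (w : (V →ₗ[ℂ] V)ˣ) := by
  simp only [ptStab, fixedSpace, toLin, Set.mem_ofPred_eq, SetLike.le_def, LinearMap.mem_ker,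
    LinearMap.sub_apply, LinearMap.id_apply, sub_eq_zero]

lemma fiber_iff {V : Type*} [AddCommGroup V] [Module ℂ V] [FiniteDimensional ℂ V]
    (W : Subgroup (V →ₗ[ℂ] V)ˣ) (H : Submodule ℂ V) (hH : H ∈ arrangement W) (w : W) :
    (w ∈ refls W ∧ fixedSpace (w : (V →ₗ[ℂ] V)ˣ) = H) ↔ (w ∈ ptStab W H ∧ w ≠ 1) := by
  obtain ⟨t, ht, rfl⟩ := hH
  have ht' : Module.finrank ℂ V =
    Module.finrank ℂ (fixedSpace (t : (V →ₗ[ℂ] V)ˣ)) + 1 := ht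
  rw [mem_ptStab_iff_le]
  constructor
  · rintro ⟨h1, h2⟩
    refine ⟨h2.ge, ?_⟩
    rintro rfl
    have h1' : Module.finrank ℂ V =
      Module.finrank ℂ (fixedSpace ((1 : W) : (V →ₗ[ℂ] V)ˣ)) + 1 := h1
    have : fixedSpace ((1 : W) : (V →ₗ[ℂ] V)ˣ) = ⊤ := by
      rw [eq_top_iff]
      intro v _
      simp [fixedSpace]
    rw [this, finrank_top] at h1'
    omega
  · rintro ⟨h1, h2⟩
    have hne : fixedSpace (w : (V →ₗ[ℂ] V)ˣ) ≠ ⊤ := by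
      intro h
      apply h2
      apply Subtype.ext
      apply Units.ext
      apply LinearMap.ext
      intro v
      have : v ∈ fixedSpace (w : (V →ₗ[ℂ] V)ˣ) := h ▸ Submodule.mem_top
      simpa [fixedSpace, sub_eq_zero] using this
    have hlt := Submodule.finrank_lt (lt_top_iff_ne_top.2 hne).ne
    have hle := Submodule.finrank_mono h1
    have heq := Submodule.eq_of_le_of_finrank_eq h1 (by omega)
    refine ⟨?_, heq.symm⟩
    change Module.finrank ℂ V = Module.finrank ℂ (fixedSpace (w : (V →ₗ[ℂ] V)ˣ)) + 1
    rw [← heq]; exact ht'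

lemma pow_mem_ptStab {V : Type*} [AddCommGroup V] [Module ℂ V]
    (W : Subgroup (V →ₗ[ℂ] V)ˣ) (H : Submodule ℂ V) (w : W) (hw : w ∈ ptStab W H) (k : ℕ) :
    w ^ k ∈ ptStab W H := by
  induction k with
  | zero => intro v _; simp [toLin]
  | succ k ih =>
    intro v hv
    have h1 := ih v hv
    have h2 := hw v hv
    simp only [toLin] at h1 h2 ⊢
    rw [pow_succ, Subgroup.coe_mul, Units.val_mul, Module.End.mul_apply, h2, h1]

/-- `χ(1)·c_χ = N(χ) + N(χ*)`: for an irreducible character `χ` of `W` afforded by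
`ρ`, and `ρ'` affording the complex-conjugate character `χ*`, with a distinguished
reflection `s H` generating each pointwise stabilizer `W_H` (with determinant
`exp(2πi/e_H)`), one has
`Σ_{t ∈ R} (χ(1) − χ(t)) = N(χ) + N(χ*)`, where
`N(χ) = Σ_{H ∈ A} Σ_{j=0}^{e_H−1} j · m^χ_{H,j}` and `m^χ_{H,j}` is the multiplicity
of `exp(2πij/e_H)` as an eigenvalue of `ρ(s H)`. -/
theorem coxeter_number_eq_N_add_N_dual
    (V : Type*) [AddCommGroup V] [Module ℂ V] [FiniteDimensional ℂ V]
    (W : Subgroup (V →ₗ[ℂ] V)ˣ) [Finite W]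
    (hgen : Subgroup.closure (refls W) = ⊤)
    (n : ℕ) (hn : 0 < n) (ρ : Representation ℂ W (Fin n → ℂ))
    (hρ : ∀ U : Submodule ℂ (Fin n → ℂ), (∀ w : W, U.map (ρ w) ≤ U) → U = ⊥ ∨ U = ⊤)
    (χ : W → ℂ) (hχ : ∀ w : W, χ w = LinearMap.trace ℂ (Fin n → ℂ) (ρ w))
    (ρ' : Representation ℂ W (Fin n → ℂ))
    (hρ' : ∀ w : W, LinearMap.trace ℂ (Fin n → ℂ) (ρ' w) = (starRingEnd ℂ) (χ w))
    (s : Submodule ℂ V → W)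
    (hs : ∀ H ∈ arrangement W, s H ∈ ptStab W H ∧
      orderOf (s H) = (ptStab W H).ncard ∧
      LinearMap.det (toLin W (s H)) =
        Complex.exp (2 * Real.pi * Complex.I / ((ptStab W H).ncard : ℂ))) :
    ∑ᶠ t ∈ refls W, (χ 1 - χ t) =
      ((∑ᶠ H ∈ arrangement W, ∑ j ∈ Finset.range ((ptStab W H).ncard),
          j * Module.finrank ℂ (Module.End.eigenspace (ρ (s H))
            (Complex.exp (2 * Real.pi * Complex.I * j / ((ptStab W H).ncard : ℂ)))) : ℕ) : ℂ) +
      ((∑ᶠ H ∈ arrangement W, ∑ j ∈ Finset.range ((ptStab W H).ncard),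
          j * Module.finrank ℂ (Module.End.eigenspace (ρ' (s H))
            (Complex.exp (2 * Real.pi * Complex.I * j / ((ptStab W H).ncard : ℂ)))) : ℕ) : ℂ) := by
  classical
  have : Fintype W := Fintype.ofFinite W
  have hRf : (refls W).Finite := Set.toFinite _
  have hAf : (arrangement W).Finite := by
    refine (hRf.image fun t : W => fixedSpace (t : (V →ₗ[ℂ] V)ˣ)).subset ?_
    rintro H ⟨t, ht, rfl⟩
    exact ⟨t, ht, rfl⟩
  rw [finsum_mem_eq_finite_toFinset_sum _ hRf, finsum_mem_eq_finite_toFinset_sum _ hAf,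
    finsum_mem_eq_finite_toFinset_sum _ hAf]
  push_cast
  rw [← Finset.sum_add_distrib, ← Finset.sum_fiberwise_of_maps_to (t := hAf.toFinset)
    (g := fun t : W => fixedSpace (t : (V →ₗ[ℂ] V)ˣ))
    (fun t ht => hAf.mem_toFinset.2 ⟨t, hRf.mem_toFinset.1 ht, rfl⟩)]
  refine Finset.sum_congr rfl fun H hH => ?_
  have hH := hAf.mem_toFinset.1 hH
  obtain ⟨hs1, hs2, -⟩ := hs H hH
  rw [← hs2]
  have hord : 0 < orderOf (s H) := orderOf_pos _
  have hpow : s H ^ orderOf (s H) = 1 := pow_orderOf_eq_one _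
  rw [← local_formula (orderOf (s H)) hord (ρ (s H)) (ρ' (s H))
    (by rw [← map_pow, hpow, map_one]) (by rw [← map_pow, hpow, map_one])
    (fun k => by rw [← map_pow, ← map_pow, hρ', hχ])]
  have himg : (Finset.range (orderOf (s H))).image (fun k => s H ^ k) =
      (ptStab W H).toFinset := by
    apply Finset.eq_of_subset_of_card_le
    · intro x hx
      obtain ⟨k, -, rfl⟩ := Finset.mem_image.1 hx
      exact Set.mem_toFinset.2 (pow_mem_ptStab W H _ hs1 k)
    · rw [Finset.card_image_of_injOn, Finset.card_range, hs2, Set.ncard_eq_toFinset_card']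
      intro i hi j hj hij
      exact pow_injOn_Iio_orderOf (by simpa using hi) (by simpa using hj) hij
  have hfib : hRf.toFinset.filter (fun t : W => fixedSpace (t : (V →ₗ[ℂ] V)ˣ) = H) =
      (ptStab W H).toFinset.erase 1 := by
    ext w
    rw [Finset.mem_filter, Finset.mem_erase, hRf.mem_toFinset, Set.mem_toFinset,
      fiber_iff W H hH, and_comm]
  rw [hfib, Finset.sum_erase _ (sub_self _), ← himg, Finset.sum_image]
  · refine Finset.sum_congr rfl fun k _ => ?_
    rw [hχ, hχ, map_one, map_pow]
  · intro i hi j hj hij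
    exact pow_injOn_Iio_orderOf (by simpa using hi) (by simpa using hj) hij
end
end

section
/- Let W be irreducible and let g ∈ W be a regular element of order d. Then for every integer m that is not divisible by d, one has Σ_{χ} χ(1)·χ(g⁻¹) = 0, where the sum is over all irreducible complex characters χ of W whose Coxeter number c_χ equals m. -/
open scoped BigOperators

noncomputable section

variable {V : Type*} [AddCommGroup V] [Module ℂ V]

namespace KZ

/-- The vector space `ℂ^N`. -/
abbrev Vc (N : ℕ) := Fin N → ℂ
/-- Polynomial functions on `ℂ^N`. -/
abbrev Po (N : ℕ) := MvPolynomial (Fin N) ℂ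

variable {N : ℕ}

open MvPolynomial

theorem po_ext {p q : Po N} (h : ∀ v, eval v p = eval v q) : p = q := MvPolynomial.funext h

/-- The linear polynomial attached to a linear form. -/
def lin (φ : Vc N →ₗ[ℂ] ℂ) : Po N := ∑ i, C (φ (Pi.single i 1)) * X i

@[simp] theorem eval_lin (φ : Vc N →ₗ[ℂ] ℂ) (v : Vc N) : eval v (lin φ) = φ v := by
  conv_rhs => rw [← Finset.univ_sum_single v, map_sum]
  simp only [lin, map_sum, map_mul, eval_C, eval_X]
  refine Finset.sum_congr rfl fun i _ => ?_
  have : (Pi.single i (v i) : Vc N) = v i • Pi.single i 1 := by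
    rw [← Pi.single_smul]; simp
  rw [this, map_smul, smul_eq_mul, mul_comm]

/-- Substitution along a linear map. -/
def sub (f : Vc N →ₗ[ℂ] Vc N) : Po N →ₐ[ℂ] Po N :=
  aeval (fun i => lin (LinearMap.proj i ∘ₗ f))

@[simp] theorem eval_sub (f : Vc N →ₗ[ℂ] Vc N) (v : Vc N) (p : Po N) :
    eval v (sub f p) = eval (f v) p := by
  induction p using MvPolynomial.induction_on with
  | C a => simp [sub]
  | add p q hp hq => simp [hp, hq]
  | mul_X p i hp => simp [hp]; left; simp [sub]

/-- Directional derivative. -/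
def pd (y : Vc N) : Derivation ℂ (Po N) (Po N) := mkDerivation ℂ (fun i => C (y i))

theorem pd_lin (y : Vc N) (φ : Vc N →ₗ[ℂ] ℂ) : pd y (lin φ) = C (φ y) := by
  apply po_ext; intro v
  simp only [pd, lin, map_sum, Derivation.leibniz, mkDerivation_X, derivation_C]
  rw [← eval_lin φ y]
  simp [lin]

theorem lin_ne_zero {φ : Vc N →ₗ[ℂ] ℂ} (h : φ ≠ 0) : lin φ ≠ 0 := by
  intro h0; apply h; ext1 v
  ext; simp
  rw [← eval_lin, h0]; simp

theorem exists_eq_one {φ : Vc N →ₗ[ℂ] ℂ} (h : φ ≠ 0) : ∃ y, φ y = 1 := by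
  obtain ⟨v, hv⟩ : ∃ v, φ v ≠ 0 := by
    by_contra hh; push Not at hh; exact h (LinearMap.ext hh)
  exact ⟨(φ v)⁻¹ • v, by simp [hv]⟩

theorem lin_dvd {φ : Vc N →ₗ[ℂ] ℂ} (h : φ ≠ 0) {p : Po N} (hp : ∀ v, φ v = 0 → eval v p = 0) :
    lin φ ∣ p := by
  obtain ⟨y, hy⟩ := exists_eq_one h
  let f : Vc N →ₗ[ℂ] Vc N := LinearMap.id - φ.smulRight y
  have h0 : sub f p = 0 := by
    apply po_ext; intro v
    rw [eval_sub, hp]; · simp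
    simp [f, hy]
  have h1 : (Ideal.Quotient.mkₐ ℂ (Ideal.span {lin φ})).comp (sub f) =
      Ideal.Quotient.mkₐ ℂ (Ideal.span {lin φ}) := by
    apply MvPolynomial.algHom_ext
    intro i
    simp only [AlgHom.comp_apply, Ideal.Quotient.mkₐ_eq_mk]
    rw [Ideal.Quotient.eq, Ideal.mem_span_singleton]
    refine ⟨-C (y i), ?_⟩
    apply po_ext; intro v
    simp [f]
  have h2 := congrArg (fun F => F p) h1
  simp only [AlgHom.comp_apply, h0, map_zero] at h2
  rw [← Ideal.mem_span_singleton, ← Ideal.Quotient.eq_zero_iff_mem]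
  exact h2.symm

theorem lin_dvd_iff {φ : Vc N →ₗ[ℂ] ℂ} (h : φ ≠ 0) {p : Po N} :
    lin φ ∣ p ↔ ∀ v, φ v = 0 → eval v p = 0 := by
  refine ⟨?_, lin_dvd h⟩
  rintro ⟨q, rfl⟩ v hv
  simp [hv]

theorem lin_prime {φ : Vc N →ₗ[ℂ] ℂ} (h : φ ≠ 0) : Prime (lin φ) := by
  refine ⟨lin_ne_zero h, ?_, ?_⟩
  · intro hu
    have := hu.map (eval (0 : Vc N))
    rw [eval_lin] at this
    simp at this
  · intro p q hpq
    rw [lin_dvd_iff h] at hpq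
    obtain ⟨y, hy⟩ := exists_eq_one h
    let f : Vc N →ₗ[ℂ] Vc N := LinearMap.id - φ.smulRight y
    have key : ∀ r : Po N, sub f r = 0 → lin φ ∣ r := by
      intro r hr
      rw [lin_dvd_iff h]
      intro v hv
      have := congrArg (eval v) hr
      simpa [f, hv] using this
    have h0 : sub f p * sub f q = 0 := by
      rw [← map_mul]
      apply po_ext; intro v
      rw [eval_sub, hpq]; · simp
      simp [f, hy]
    rcases mul_eq_zero.1 h0 with h1 | h1
    · exact Or.inl (key _ h1)
    · exact Or.inr (key _ h1)

/-- Homogeneity of integral degree, by evaluation. -/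
def Hom (k : ℤ) (p : Po N) : Prop := ∀ c : ℂ, c ≠ 0 → ∀ v, eval (c • v) p = c ^ k * eval v p

theorem Hom.add {k : ℤ} {p q : Po N} (hp : Hom k p) (hq : Hom k q) : Hom k (p + q) := by
  intro c hc v; simp [hp c hc v, hq c hc v, mul_add]

theorem Hom.zero {k : ℤ} : Hom k (0 : Po N) := by
  intro c hc v; simp

theorem Hom.sub {k : ℤ} {p q : Po N} (hp : Hom k p) (hq : Hom k q) : Hom k (p - q) := by
  intro c hc v; simp [hp c hc v, hq c hc v, mul_sub]

theorem Hom.sum {ι : Type*} {s : Finset ι} {k : ℤ} {p : ι → Po N} (hp : ∀ i ∈ s, Hom k (p i)) :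
    Hom k (∑ i ∈ s, p i) := by
  intro c hc v
  simp only [map_sum, Finset.mul_sum]
  exact Finset.sum_congr rfl fun i hi => hp i hi c hc v

theorem Hom.mul {k l : ℤ} {p q : Po N} (hp : Hom k p) (hq : Hom l q) : Hom (k + l) (p * q) := by
  intro c hc v; simp [hp c hc v, hq c hc v, zpow_add₀ hc]; ring

theorem Hom.C_mul {k : ℤ} {p : Po N} (a : ℂ) (hp : Hom k p) : Hom k (C a * p) := by
  intro c hc v; simp [hp c hc v]; ring

theorem Hom.smul {k : ℤ} {p : Po N} (a : ℂ) (hp : Hom k p) : Hom k (a • p) := by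
  rw [MvPolynomial.smul_eq_C_mul]; exact hp.C_mul a

theorem Hom.one : Hom 0 (1 : Po N) := by
  intro c hc v; simp

theorem Hom.pow {k : ℤ} {p : Po N} (hp : Hom k p) (n : ℕ) : Hom (n * k) (p ^ n) := by
  intro c hc v; simp only [map_pow, hp c hc v, mul_pow]
  rw [mul_comm (n : ℤ), zpow_mul, zpow_natCast]

theorem Hom.prod {ι : Type*} {s : Finset ι} {k : ι → ℤ} {p : ι → Po N}
    (hp : ∀ i ∈ s, Hom (k i) (p i)) : Hom (∑ i ∈ s, k i) (∏ i ∈ s, p i) := by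
  classical
  induction s using Finset.induction_on with
  | empty => simpa using Hom.one
  | insert a s ha ih =>
    rw [Finset.sum_insert ha, Finset.prod_insert ha]
    exact (hp a (by simp)).mul (ih fun i hi => hp i (by simp [hi]))

theorem Hom.lin (φ : Vc N →ₗ[ℂ] ℂ) : Hom 1 (lin φ) := by
  intro c hc v; simp

theorem Hom.subst {k : ℤ} {p : Po N} (hp : Hom k p) (f : Vc N →ₗ[ℂ] Vc N) : Hom k (KZ.sub f p) := by
  intro c hc v; simp [hp c hc]

theorem Hom.of_mul {k l : ℤ} {p q : Po N} (hp0 : p ≠ 0) (hp : Hom k p) (hq : Hom l (p * q)) :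
    Hom (l - k) q := by
  intro c hc v
  have key : p * (KZ.sub (c • LinearMap.id) q - C (c ^ (l - k)) * q) = 0 := by
    apply po_ext; intro w
    have h1 := hq c hc w
    simp only [map_mul, hp c hc w] at h1
    have hck : c ^ k ≠ 0 := zpow_ne_zero _ hc
    simp only [map_mul, map_sub, eval_sub, eval_C, LinearMap.smul_apply, LinearMap.id_apply,
      map_zero]
    apply mul_left_cancel₀ hck
    rw [zpow_sub₀ hc]
    field_simp
    linear_combination h1
  have h2 := (mul_eq_zero.1 key).resolve_left hp0
  have := congrArg (eval v) h2
  simpa [sub_eq_zero] using this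

theorem Hom.eq_zero_of_neg {k : ℤ} (hk : k < 0) {p : Po N} (hp : Hom k p) : p = 0 := by
  apply po_ext; intro v
  obtain ⟨n, hn⟩ : ∃ n : ℕ, k = -((n : ℤ) + 1) := ⟨(-k - 1).toNat, by omega⟩
  let q : Polynomial ℂ := aeval (fun i => Polynomial.C (v i) * Polynomial.X) p
  have hq : ∀ c, q.eval c = eval (c • v) p := by
    intro c
    simp only [q]
    rw [← Polynomial.coe_aeval_eq_eval, ← AlgHom.comp_apply, MvPolynomial.comp_aeval, ← coe_aeval_eq_eval]
    simp only [RingHom.coe_coe]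
    congr 2
    ext i; simp; try ring
  have h : (Polynomial.X ^ (n + 1) * q - Polynomial.C (eval v p)) = 0 := by
    apply Polynomial.eq_zero_of_infinite_isRoot
    apply Set.Infinite.mono (s := {0}ᶜ)
    · intro c hc
      have hc : c ≠ 0 := hc
      simp only [Set.mem_ofPred_eq, Polynomial.IsRoot.def, Polynomial.eval_sub, Polynomial.eval_mul,
        Polynomial.eval_pow, Polynomial.eval_X, Polynomial.eval_C, hq, hp c hc v, hn]
      rw [zpow_neg, ← mul_assoc]
      have : (c : ℂ) ^ ((n : ℤ) + 1) = c ^ (n + 1) := by exact_mod_cast zpow_natCast c (n + 1)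
      rw [this, mul_inv_cancel₀ (pow_ne_zero _ hc)]; simp
    · exact (Set.finite_singleton _).infinite_compl
  have := congrArg (Polynomial.eval 0) h
  simpa using this

/-- Restriction to a line. -/
def ln (v y : Vc N) : Po N →ₐ[ℂ] Polynomial ℂ :=
  aeval (fun i => Polynomial.C (v i) + Polynomial.C (y i) * Polynomial.X)

theorem eval_ln (v y : Vc N) (p : Po N) (c : ℂ) : (ln v y p).eval c = eval (v + c • y) p := by
  simp only [ln]
  rw [← Polynomial.coe_aeval_eq_eval, ← AlgHom.comp_apply, MvPolynomial.comp_aeval, ← coe_aeval_eq_eval]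
  simp only [RingHom.coe_coe]
  congr 2
  ext i; simp; try ring

theorem deriv_ln (v y : Vc N) (p : Po N) :
    Polynomial.derivative (ln v y p) = ln v y (pd y p) := by
  induction p using MvPolynomial.induction_on with
  | C a => simp [ln, pd]
  | add p q hp hq => simp [hp, hq]
  | mul_X p i hp =>
    simp [hp, Derivation.leibniz]
    simp [ln, pd]
    ring

theorem Hom.euler {k : ℤ} {p : Po N} (hp : Hom k p) (v : Vc N) :
    eval v (pd v p) = k * eval v p := by
  rcases lt_or_ge k 0 with hk | hk
  · rw [hp.eq_zero_of_neg hk]; simp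
  obtain ⟨n, rfl⟩ := Int.eq_ofNat_of_zero_le hk
  have h : ln 0 v p = Polynomial.C (eval v p) * Polynomial.X ^ n := by
    rw [← sub_eq_zero]
    apply Polynomial.eq_zero_of_infinite_isRoot
    apply Set.Infinite.mono (s := {0}ᶜ)
    · intro c hc
      have hc : c ≠ 0 := hc
      simp [eval_ln, hp c hc v]; ring
    · exact (Set.finite_singleton _).infinite_compl
  have h2 := deriv_ln 0 v p
  rw [h] at h2
  have := congrArg (Polynomial.eval 1) h2
  rw [eval_ln] at this
  simp [Polynomial.derivative_X_pow] at this
  rw [← this]; push_cast; ring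

theorem pd_sub_smul (c : ℂ) (y : Vc N) (p : Po N) :
    pd y (sub (c • LinearMap.id) p) = C c * sub (c • LinearMap.id) (pd y p) := by
  induction p using MvPolynomial.induction_on with
  | C a => simp [sub, pd]
  | add p q hp hq => simp [hp, hq, mul_add]
  | mul_X p i hp =>
    simp only [map_mul, Derivation.leibniz, hp, smul_eq_mul, map_add]
    have h1 : sub (c • LinearMap.id) (X i : Po N) = C c * X i := by
      apply po_ext; intro v; simp
    have h2 : sub (c • LinearMap.id) (pd y (X i : Po N)) = C (y i) := by
      simp [sub, pd]
    rw [h1, h2]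
    simp [pd, Derivation.leibniz]
    ring

theorem Hom.pd {k : ℤ} {p : Po N} (hp : Hom k p) (y : Vc N) : Hom (k - 1) (pd y p) := by
  intro c hc v
  have h : KZ.sub (c • LinearMap.id) p = C (c ^ k) * p := by
    apply po_ext; intro w; simp [hp c hc w]
  have h2 := pd_sub_smul c y p
  rw [h] at h2
  have h3 := congrArg (eval v) h2
  simp [Derivation.leibniz, KZ.pd] at h3
  rw [zpow_sub₀ hc]
  field_simp
  simp only [KZ.pd]
  linear_combination -h3

/-- Dividing a linear map by a fixed polynomial. -/
theorem exists_div {D : Type*} [AddCommGroup D] [Module ℂ D] {a : Po N} (ha : a ≠ 0)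
    (L : D →ₗ[ℂ] Po N) (h : ∀ d, a ∣ L d) : ∃ G : D →ₗ[ℂ] Po N, ∀ d, a * G d = L d := by
  choose G hG using h
  refine ⟨⟨⟨G, ?_⟩, ?_⟩, fun d => (hG d).symm⟩
  · intro x y
    apply mul_left_cancel₀ ha
    rw [← hG, mul_add, ← hG, ← hG, map_add]
  · intro c x
    apply mul_left_cancel₀ ha
    simp only [RingHom.id_apply]
    rw [← hG, mul_smul_comm, ← hG, map_smul]

end KZ

namespace KZ
open MvPolynomial
open scoped Classical
set_option linter.unusedSectionVars false

variable {N : ℕ} {G : Type*} [Group G] [Fintype G]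

/-- Fixed space of a group element. -/
def fx (τ : Representation ℂ G (Vc N)) (t : G) : Submodule ℂ (Vc N) :=
  LinearMap.ker (τ t - LinearMap.id)

theorem mem_fx {τ : Representation ℂ G (Vc N)} {t : G} {v : Vc N} : v ∈ fx τ t ↔ τ t v = v := by
  simp [fx, sub_eq_zero]

/-- The reflections. -/
def Rf (τ : Representation ℂ G (Vc N)) : Finset G :=
  Finset.univ.filter fun t => N = Module.finrank ℂ (fx τ t) + 1

/-- A chosen linear form with a given kernel. -/
def frm (H : Submodule ℂ (Vc N)) : Vc N →ₗ[ℂ] ℂ :=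
  if h : ∃ φ : Vc N →ₗ[ℂ] ℂ, LinearMap.ker φ = H then h.choose else 0

/-- The linear form of a reflection. -/
def al (τ : Representation ℂ G (Vc N)) (t : G) : Vc N →ₗ[ℂ] ℂ := frm (fx τ t)

theorem ker_frm {H : Submodule ℂ (Vc N)} (h : N = Module.finrank ℂ H + 1) :
    LinearMap.ker (frm H) = H := by
  have hlt : H < ⊤ := by
    rw [lt_top_iff_ne_top]; rintro rfl
    rw [finrank_top] at h; simp at h
  obtain ⟨f, hf, hle⟩ := Submodule.exists_le_ker_of_lt_top H hlt
  have : ∃ φ : Vc N →ₗ[ℂ] ℂ, LinearMap.ker φ = H := by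
    refine ⟨f, (Submodule.eq_of_le_of_finrank_le hle ?_).symm⟩
    have h1 : LinearMap.ker f < ⊤ := by
      rw [lt_top_iff_ne_top]; intro h2; exact hf (LinearMap.ker_eq_top.1 h2)
    have := Submodule.finrank_lt h1.ne
    simp at this
    omega
  rw [frm, dif_pos this]; exact this.choose_spec

theorem frm_ne_zero {H : Submodule ℂ (Vc N)} (h : N = Module.finrank ℂ H + 1) : frm H ≠ 0 := by
  intro h0
  have := ker_frm h
  rw [h0, LinearMap.ker_zero] at this
  rw [← this, finrank_top] at h; simp at h

variable {τ : Representation ℂ G (Vc N)}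

theorem ker_al {t : G} (ht : t ∈ Rf τ) : LinearMap.ker (al τ t) = fx τ t :=
  ker_frm (by simpa [Rf] using ht)

theorem al_ne_zero {t : G} (ht : t ∈ Rf τ) : al τ t ≠ 0 :=
  frm_ne_zero (by simpa [Rf] using ht)

theorem al_eq_zero {t : G} (ht : t ∈ Rf τ) {v : Vc N} : al τ t v = 0 ↔ τ t v = v := by
  rw [← mem_fx, ← ker_al ht, LinearMap.mem_ker]

/-- The pointwise stabilizer of a subspace. -/
def st (τ : Representation ℂ G (Vc N)) (H : Submodule ℂ (Vc N)) : Subgroup G where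
  carrier := {s | ∀ v ∈ H, τ s v = v}
  mul_mem' := by
    intro a b ha hb v hv
    rw [map_mul, Module.End.mul_apply, hb v hv, ha v hv]
  one_mem' := by intro v hv; simp
  inv_mem' := by
    intro a ha v hv
    conv_lhs => rw [← ha v hv]
    rw [← Module.End.mul_apply, ← map_mul]; simp

theorem mem_st {H : Submodule ℂ (Vc N)} {s : G} : s ∈ st τ H ↔ ∀ v ∈ H, τ s v = v := Iff.rfl

theorem mem_st_iff_le {H : Submodule ℂ (Vc N)} {s : G} : s ∈ st τ H ↔ H ≤ fx τ s := by
  rw [mem_st]; exact ⟨fun h v hv => mem_fx.2 (h v hv), fun h v hv => mem_fx.1 (h hv)⟩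

theorem fx_eq_of_mem_st (hτ : Function.Injective τ) {t s : G} (ht : t ∈ Rf τ)
    (hs : s ∈ st τ (fx τ t)) (h1 : s ≠ 1) : fx τ s = fx τ t := by
  have hle := mem_st_iff_le.1 hs
  have ht' : N = Module.finrank ℂ (fx τ t) + 1 := by simpa [Rf] using ht
  symm
  apply Submodule.eq_of_le_of_finrank_le hle
  have h2 : fx τ s < ⊤ := by
    rw [lt_top_iff_ne_top]; intro h2
    apply h1; apply hτ
    rw [map_one]
    refine LinearMap.ext fun v => ?_
    have : v ∈ fx τ s := h2 ▸ Submodule.mem_top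
    rw [mem_fx.1 this]; rfl
  have := Submodule.finrank_lt h2.ne
  simp at this
  omega

theorem mem_Rf_of_mem_st (hτ : Function.Injective τ) {t s : G} (ht : t ∈ Rf τ)
    (hs : s ∈ st τ (fx τ t)) (h1 : s ≠ 1) : s ∈ Rf τ := by
  have ht' : N = Module.finrank ℂ (fx τ t) + 1 := by simpa [Rf] using ht
  simp only [Rf, Finset.mem_filter, Finset.mem_univ, true_and]
  rw [fx_eq_of_mem_st hτ ht hs h1]; exact ht'

theorem one_notMem_Rf : (1 : G) ∉ Rf τ := by
  have : fx τ 1 = ⊤ := by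
    rw [eq_top_iff]; intro v _; rw [mem_fx]; simp
  simp only [Rf, Finset.mem_filter, Finset.mem_univ, true_and]
  rw [this, finrank_top]; simp

theorem self_mem_st (t : G) : t ∈ st τ (fx τ t) := mem_st_iff_le.2 le_rfl

/-- Order of the pointwise stabilizer of the hyperplane of `t`. -/
def ee (τ : Representation ℂ G (Vc N)) (H : Submodule ℂ (Vc N)) : ℕ := Nat.card (st τ H)

/-- The multiplier of `s` on the linear form. -/
theorem exists_mult {t s : G} (ht : t ∈ Rf τ) (hs : s ∈ st τ (fx τ t)) :
    ∃ c : ℂ, (∀ v, al τ t (τ s v) = c * al τ t v) := by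
  obtain ⟨y, hy⟩ := exists_eq_one (al_ne_zero ht)
  refine ⟨al τ t (τ s y), fun v => ?_⟩
  have h1 : v - al τ t v • y ∈ fx τ t := by
    rw [← ker_al ht]; simp [hy]
  have h2 := hs _ h1
  have h3 := congrArg (al τ t) h2
  simp [hy] at h3
  linear_combination h3

/-- The action of the group on polynomial functions. -/
def act (τ : Representation ℂ G (Vc N)) (w : G) : Po N →ₐ[ℂ] Po N := sub (τ w⁻¹)

@[simp] theorem eval_act (w : G) (v : Vc N) (p : Po N) : eval v (act τ w p) = eval (τ w⁻¹ v) p := by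
  simp [act]

theorem act_one (p : Po N) : act τ 1 p = p := by apply po_ext; intro v; simp

theorem act_mul (a b : G) (p : Po N) : act τ (a * b) p = act τ a (act τ b p) := by
  apply po_ext; intro v; simp

theorem act_lin (w : G) (φ : Vc N →ₗ[ℂ] ℂ) : act τ w (lin φ) = lin (φ ∘ₗ τ w⁻¹) := by
  apply po_ext; intro v; simp

theorem dvd_sub_act {t s : G} (ht : t ∈ Rf τ) (hs : s ∈ st τ (fx τ t)) (p : Po N) :
    lin (al τ t) ∣ p - act τ s p := by
  apply lin_dvd (al_ne_zero ht)
  intro v hv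
  have : v ∈ fx τ t := by rw [← ker_al ht]; exact hv
  have h2 := (st τ (fx τ t)).inv_mem hs v this
  simp [h2]

theorem act_lin_pow {t s : G} (ht : t ∈ Rf τ) (hs : s ∈ st τ (fx τ t)) :
    act τ s (lin (al τ t) ^ ee τ (fx τ t)) = lin (al τ t) ^ ee τ (fx τ t) := by
  obtain ⟨c, hc⟩ := exists_mult ht ((st τ (fx τ t)).inv_mem hs)
  have h1 : ∀ k : ℕ, ∀ v, al τ t (τ (s⁻¹ ^ k) v) = c ^ k * al τ t v := by
    intro k
    induction k with
    | zero => simp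
    | succ k ih =>
      intro v
      rw [pow_succ', map_mul, Module.End.mul_apply, hc, ih]; ring
  have h2 : s⁻¹ ^ ee τ (fx τ t) = 1 := by
    have := pow_card_eq_one' (x := (⟨s⁻¹, (st τ (fx τ t)).inv_mem hs⟩ : st τ (fx τ t)))
    exact congrArg Subtype.val this
  obtain ⟨y, hy⟩ := exists_eq_one (al_ne_zero ht)
  have h3 := h1 (ee τ (fx τ t)) y
  rw [h2] at h3
  simp [hy] at h3
  apply po_ext; intro v
  simp [hc, mul_pow, ← h3]

theorem st_comm (hτ : Function.Injective τ) {t a b : G} (ht : t ∈ Rf τ)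
    (ha : a ∈ st τ (fx τ t)) (hb : b ∈ st τ (fx τ t)) : a * b = b * a := by
  set c := (b * a)⁻¹ * (a * b) with hcdef
  have hc : c ∈ st τ (fx τ t) :=
    (st τ (fx τ t)).mul_mem ((st τ (fx τ t)).inv_mem ((st τ (fx τ t)).mul_mem hb ha))
      ((st τ (fx τ t)).mul_mem ha hb)
  suffices h : c = 1 by
    have := inv_mul_eq_one.1 h
    exact this.symm
  obtain ⟨y, hy⟩ := exists_eq_one (al_ne_zero ht)
  have hal : ∀ v, al τ t (τ c v) = al τ t v := by
    obtain ⟨ca, hca⟩ := exists_mult ht ha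
    obtain ⟨cb, hcb⟩ := exists_mult ht hb
    obtain ⟨cc, hcc⟩ := exists_mult ht hc
    have h1 : ∀ v, al τ t (τ ((b * a) * c) v) = al τ t (τ (a * b) v) := by
      intro v; rw [hcdef]; simp
    have h2 := h1 y
    simp only [map_mul, Module.End.mul_apply, hca, hcb, hcc, hy] at h2
    have ca0 : ca ≠ 0 := by
      rintro rfl
      have := hca (τ a⁻¹ y)
      rw [← Module.End.mul_apply, ← map_mul] at this
      simp [hy] at this
    have cb0 : cb ≠ 0 := by
      rintro rfl
      have := hcb (τ b⁻¹ y)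
      rw [← Module.End.mul_apply, ← map_mul] at this
      simp [hy] at this
    have h3 : cc = 1 := by
      have : cb * ca ≠ 0 := mul_ne_zero cb0 ca0
      apply mul_left_cancel₀ this
      linear_combination h2
    intro v; rw [hcc, h3, one_mul]
  set r := τ c y - y with hr
  have hr0 : r ∈ fx τ t := by
    rw [← ker_al ht]; simp [hr, hal]
  have hv : ∀ v, τ c v = v + al τ t v • r := by
    intro v
    have h1 : v - al τ t v • y ∈ fx τ t := by
      rw [← ker_al ht]; simp [hy]
    have h2 := hc _ h1
    simp only [map_sub, map_smul] at h2
    rw [hr, smul_sub]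
    rw [sub_eq_iff_eq_add] at h2
    rw [h2]; abel
  have hk : ∀ k : ℕ, τ (c ^ k) y = y + (k : ℂ) • r := by
    intro k
    induction k with
    | zero => simp
    | succ k ih =>
      rw [pow_succ', map_mul, Module.End.mul_apply, ih, map_add, map_smul, hc _ hr0, hv y, hy]
      push_cast
      rw [add_smul]; simp; abel
  have h1 := hk (Fintype.card G)
  rw [pow_card_eq_one] at h1
  have h2 : r = 0 := by
    simp at h1
    exact h1
  apply hτ
  rw [map_one]
  refine LinearMap.ext fun v => ?_
  rw [hv, h2]; simp

theorem fx_conj (w t : G) {v : Vc N} : v ∈ fx τ (w * t * w⁻¹) ↔ τ w⁻¹ v ∈ fx τ t := by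
  rw [mem_fx, mem_fx, map_mul, map_mul, Module.End.mul_apply, Module.End.mul_apply]
  constructor
  · intro h
    conv_rhs => rw [← h]
    rw [← Module.End.mul_apply, ← map_mul]; simp
  · intro h
    rw [h, ← Module.End.mul_apply, ← map_mul]; simp

theorem fx_conj_eq (w t : G) : fx τ (w * t * w⁻¹) = (fx τ t).map (τ w) := by
  ext v
  rw [fx_conj, Submodule.mem_map]
  constructor
  · intro h; exact ⟨_, h, by rw [← Module.End.mul_apply, ← map_mul]; simp⟩
  · rintro ⟨u, hu, rfl⟩
    rw [← Module.End.mul_apply, ← map_mul]; simpa using hu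

theorem rep_inj (w : G) : Function.Injective (τ w) := by
  intro u v h
  have := congrArg (τ w⁻¹) h
  rw [← Module.End.mul_apply, ← map_mul, ← Module.End.mul_apply, ← map_mul] at this
  simpa using this

theorem conj_mem_Rf {t : G} (ht : t ∈ Rf τ) (w : G) : w * t * w⁻¹ ∈ Rf τ := by
  simp only [Rf, Finset.mem_filter, Finset.mem_univ, true_and] at ht ⊢
  rw [fx_conj_eq, (Submodule.equivMapOfInjective (τ w) (rep_inj w) _).finrank_eq.symm]
  exact ht

theorem conj_mem_st {t s : G} (w : G) (hs : s ∈ st τ (fx τ t)) :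
    w * s * w⁻¹ ∈ st τ (fx τ (w * t * w⁻¹)) := by
  intro v hv
  rw [fx_conj] at hv
  have := hs _ hv
  rw [← mem_fx, fx_conj, mem_fx]; exact this

theorem ee_conj (w t : G) : ee τ (fx τ (w * t * w⁻¹)) = ee τ (fx τ t) := by
  have key : ∀ w t : G, ee τ (fx τ t) ≤ ee τ (fx τ (w * t * w⁻¹)) := by
    intro w t
    refine Nat.card_le_card_of_injective
      (fun s : st τ (fx τ t) => (⟨w * s * w⁻¹, conj_mem_st w s.2⟩ : st τ (fx τ (w * t * w⁻¹)))) ?_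
    intro a b h
    simp at h
    exact h
  apply le_antisymm _ (key w t)
  have := key w⁻¹ (w * t * w⁻¹)
  simpa [mul_assoc] using this

theorem dvd_act_conj {t : G} (ht : t ∈ Rf τ) (w : G) :
    lin (al τ (w * t * w⁻¹)) ∣ act τ w (lin (al τ t)) := by
  apply lin_dvd (al_ne_zero (conj_mem_Rf ht w))
  intro v hv
  rw [eval_act, eval_lin]
  have h1 : v ∈ fx τ (w * t * w⁻¹) := by rw [← ker_al (conj_mem_Rf ht w)]; exact hv
  rw [fx_conj, ← ker_al ht] at h1
  exact h1

theorem inv_mem_Rf {t : G} (ht : t ∈ Rf τ) : t⁻¹ ∈ Rf τ := by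
  have : fx τ t⁻¹ = fx τ t := by
    ext v; rw [mem_fx, mem_fx]
    constructor
    · intro h
      conv_lhs => rw [← h]
      rw [← Module.End.mul_apply, ← map_mul]; simp
    · intro h
      conv_lhs => rw [← h]
      rw [← Module.End.mul_apply, ← map_mul]; simp
  simp only [Rf, Finset.mem_filter, Finset.mem_univ, true_and] at ht ⊢
  rw [this]; exact ht

end KZ

namespace KZ
open MvPolynomial
open scoped Classical
set_option linter.unusedSectionVars false

variable {N n : ℕ} {G : Type*} [Group G] [Fintype G]

/-- The representation of `G` on linear maps into polynomial functions. -/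
def ho (τ : Representation ℂ G (Vc N)) (ρ : Representation ℂ G (Vc n)) :
    Representation ℂ G (Vc n →ₗ[ℂ] Po N) where
  toFun w :=
    { toFun := fun F => (act τ w).toLinearMap ∘ₗ F ∘ₗ ρ w⁻¹
      map_add' := by intro a b; refine LinearMap.ext fun d => ?_; simp
      map_smul' := by intro a b; refine LinearMap.ext fun d => ?_; simp }
  map_one' := by
    refine LinearMap.ext fun F => LinearMap.ext fun d => ?_
    simp [act_one]
  map_mul' a b := by
    refine LinearMap.ext fun F => LinearMap.ext fun d => ?_
    simp [act_mul]

variable {τ : Representation ℂ G (Vc N)} {ρ : Representation ℂ G (Vc n)}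

@[simp] theorem ho_apply (w : G) (F : Vc n →ₗ[ℂ] Po N) (d : Vc n) :
    ho τ ρ w F d = act τ w (F (ρ w⁻¹ d)) := rfl

/-- The quasi-invariance condition. -/
def InQ (τ : Representation ℂ G (Vc N)) (ρ : Representation ℂ G (Vc n))
    (F : Vc n →ₗ[ℂ] Po N) : Prop :=
  ∀ t ∈ Rf τ, ∀ s ∈ st τ (fx τ t), ∀ d, lin (al τ t) ^ ee τ (fx τ t) ∣ F (d - ρ s d)

theorem InQ.add {F F' : Vc n →ₗ[ℂ] Po N} (h : InQ τ ρ F) (h' : InQ τ ρ F') : InQ τ ρ (F + F') :=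
  fun t ht s hs d => dvd_add (h t ht s hs d) (h' t ht s hs d)

theorem InQ.zero : InQ τ ρ 0 :=
  fun t ht s hs d => by simp

theorem InQ.smul (c : ℂ) {F : Vc n →ₗ[ℂ] Po N} (h : InQ τ ρ F) : InQ τ ρ (c • F) :=
  fun t ht s hs d => by
    rw [LinearMap.smul_apply, MvPolynomial.smul_eq_C_mul]
    exact (h t ht s hs d).mul_left _

theorem rep_cancel {m : ℕ} (ρ : Representation ℂ G (Vc m)) (w : G) (d : Vc m) :
    ρ w (ρ w⁻¹ d) = d := by
  rw [← Module.End.mul_apply, ← map_mul]; simp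

theorem InQ.ho (w : G) {F : Vc n →ₗ[ℂ] Po N} (h : InQ τ ρ F) : InQ τ ρ (ho τ ρ w F) := by
  intro t ht s hs d
  rw [ho_apply]
  have h1 := conj_mem_Rf ht w⁻¹
  have h2 := conj_mem_st (w⁻¹) hs
  have h3 := h _ h1 _ h2 (ρ w⁻¹ d)
  have h4 : ρ w⁻¹ d - ρ (w⁻¹ * s * w⁻¹⁻¹) (ρ w⁻¹ d) = ρ w⁻¹ (d - ρ s d) := by
    rw [map_sub, map_mul, map_mul]
    simp only [Module.End.mul_apply]
    simp
  rw [h4, ee_conj] at h3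
  refine dvd_trans ?_ (map_dvd (act τ w) h3)
  rw [map_pow]
  apply pow_dvd_pow_of_dvd
  have h5 := dvd_act_conj h1 w
  simpa [mul_assoc] using h5

theorem card_st (H : Submodule ℂ (Vc N)) :
    (Finset.univ.filter fun s => s ∈ st τ H).card = ee τ H := by
  rw [ee, Nat.card_eq_fintype_card, Fintype.card_subtype]

theorem al_of_mem_st (hτ : Function.Injective τ) {t r : G} (hr : r ∈ Rf τ) (h : t ∈ st τ (fx τ r))
    (h1 : t ≠ 1) : al τ t = al τ r := by
  rw [al, al, fx_eq_of_mem_st hτ hr h h1]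

theorem not_dvd_of_notMem {t r : G} (hr : r ∈ Rf τ) (ht : t ∈ Rf τ)
    (h : fx τ r ≠ fx τ t) : ¬ lin (al τ r) ∣ lin (al τ t) := by
  rw [lin_dvd_iff (al_ne_zero hr)]
  intro hh
  apply h
  simp only [Rf, Finset.mem_filter, Finset.mem_univ, true_and] at hr ht
  have hr' : r ∈ Rf τ := by simpa [Rf] using hr
  have ht' : t ∈ Rf τ := by simpa [Rf] using ht
  apply Submodule.eq_of_le_of_finrank_eq
  · intro v hv
    rw [← ker_al hr'] at hv
    rw [← ker_al ht']
    simpa using hh v hv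
  · omega

theorem dunkl (hτ : Function.Injective τ) {F : Vc n →ₗ[ℂ] Po N} (hF : InQ τ ρ F) :
    ∃ Gt : G → (Vc n →ₗ[ℂ] Po N), (∀ t ∈ Rf τ, ∀ d, lin (al τ t) * Gt t d = F d - ho τ ρ t F d) ∧
      ∀ y, InQ τ ρ ((pd y).toLinearMap ∘ₗ F - ∑ t ∈ Rf τ, (al τ t y) • Gt t) := by
  have h1 : ∀ t ∈ Rf τ, ∃ Gt : Vc n →ₗ[ℂ] Po N, ∀ d, lin (al τ t) * Gt d = F d - ho τ ρ t F d := by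
    intro t ht
    refine exists_div (lin_ne_zero (al_ne_zero ht)) (F - ho τ ρ t F) fun d => ?_
    have e1 : (F - ho τ ρ t F) d = F (d - ρ t⁻¹ d) + (F (ρ t⁻¹ d) - act τ t (F (ρ t⁻¹ d))) := by
      simp
    rw [e1]
    refine dvd_add ?_ (dvd_sub_act ht (self_mem_st t) _)
    refine dvd_trans (dvd_pow_self _ ?_)
      (hF t ht t⁻¹ ((st τ (fx τ t)).inv_mem (self_mem_st t)) d)
    rw [ee]; exact Nat.card_pos.ne'
  choose! Gt hGt using h1
  refine ⟨Gt, hGt, fun y r hr s hs d => ?_⟩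
  set a := lin (al τ r) with ha
  set e := ee τ (fx τ r) with he
  have hprime : Prime a := lin_prime (al_ne_zero hr)
  set δ := d - ρ s d with hδ
  simp only [LinearMap.sub_apply, LinearMap.comp_apply, LinearMap.sum_apply, LinearMap.smul_apply]
  rw [← Finset.sum_filter_add_sum_filter_not (Rf τ) (fun t => t ∈ st τ (fx τ r)), ← sub_sub]
  refine dvd_sub ?_ ?_
  swap
  · apply Finset.dvd_sum
    intro t ht
    rw [Finset.mem_filter] at ht
    rw [MvPolynomial.smul_eq_C_mul]
    apply Dvd.dvd.mul_left
    have h2 : a ^ e ∣ lin (al τ t) * Gt t δ := by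
      rw [hGt t ht.1]
      exact dvd_sub (hF r hr s hs d) ((hF.ho t) r hr s hs d)
    refine hprime.pow_dvd_of_dvd_mul_left e ?_ h2
    apply not_dvd_of_notMem hr ht.1
    intro hh; apply ht.2; rw [hh]; exact self_mem_st t
  · -- terms in the stabilizer
    choose P' hP0 using fun d => hF r hr s hs d
    have hP' : ∀ d, F (d - ρ s d) = a ^ e * P' d := hP0
    set A := Finset.univ.filter fun s => s ∈ st τ (fx τ r) with hA
    have hfil : (Rf τ).filter (fun t => t ∈ st τ (fx τ r)) = A.erase 1 := by
      ext t
      simp only [Finset.mem_filter, Finset.mem_erase, hA, Finset.mem_univ, true_and]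
      constructor
      · rintro ⟨h1, h2⟩
        exact ⟨fun h => one_notMem_Rf (h ▸ h1), h2⟩
      · rintro ⟨h1, h2⟩
        exact ⟨mem_Rf_of_mem_st hτ hr h2 h1, h2⟩
    rw [hfil]
    have hsum : ∀ t ∈ A.erase 1, al τ t y • Gt t δ = C (al τ r y) * Gt t δ := by
      intro t ht
      simp only [hA, Finset.mem_erase, Finset.mem_filter, Finset.mem_univ, true_and] at ht
      rw [MvPolynomial.smul_eq_C_mul, al_of_mem_st hτ hr ht.2 ht.1]
    rw [Finset.sum_congr rfl hsum, ← Finset.mul_sum]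
    have hone : (1 : G) ∈ A := by simp [hA, (st τ (fx τ r)).one_mem]
    have hPt : ∀ t ∈ A, ho τ ρ t F δ = a ^ e * act τ t (P' (ρ t⁻¹ d)) := by
      intro t ht
      simp only [hA, Finset.mem_filter, Finset.mem_univ, true_and] at ht
      have hc : ρ t⁻¹ δ = ρ t⁻¹ d - ρ s (ρ t⁻¹ d) := by
        rw [hδ, map_sub, ← Module.End.mul_apply, ← map_mul, ← Module.End.mul_apply, ← map_mul,
          st_comm hτ hr ((st τ (fx τ r)).inv_mem ht) hs]
      rw [ho_apply, hc, hP', map_mul, act_lin_pow hr ht]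
    have hFδ : F δ = a ^ e * P' d := hP' d
    have hG : a * ∑ t ∈ A.erase 1, Gt t δ =
        (e : Po N) * (a ^ e * P' d) - a ^ e * ∑ t ∈ A, act τ t (P' (ρ t⁻¹ d)) := by
      have h3 : ∀ t ∈ A.erase 1, a * Gt t δ = F δ - ho τ ρ t F δ := by
        intro t ht
        simp only [hA, Finset.mem_erase, Finset.mem_filter, Finset.mem_univ, true_and] at ht
        rw [← hGt t (mem_Rf_of_mem_st hτ hr ht.2 ht.1), al_of_mem_st hτ hr ht.2 ht.1]
      rw [Finset.mul_sum, Finset.sum_congr rfl h3]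
      rw [Finset.sum_erase A (f := fun t => F δ - ho τ ρ t F δ) (by simp [act_one])]
      rw [Finset.sum_sub_distrib, Finset.sum_const, card_st, Finset.sum_congr rfl hPt,
        ← Finset.mul_sum, hFδ, nsmul_eq_mul]
    have hdiv : a ∣ ∑ t ∈ A, act τ t (P' (ρ t⁻¹ d)) := by
      have h0 : ∑ t ∈ A, P' (ρ t⁻¹ d) = 0 := by
        have hne : a ^ e ≠ 0 := pow_ne_zero _ hprime.ne_zero
        apply mul_left_cancel₀ hne
        rw [Finset.mul_sum, mul_zero]
        have h9 : ∀ t ∈ A, a ^ e * P' (ρ t⁻¹ d) = F (ρ t⁻¹ d) - F (ρ s (ρ t⁻¹ d)) := by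
          intro t _
          rw [← hP', map_sub]
        rw [Finset.sum_congr rfl h9]
        rw [Finset.sum_sub_distrib, sub_eq_zero]
        refine Finset.sum_bij' (fun t _ => t * s) (fun t _ => t * s⁻¹) ?_ ?_ ?_ ?_ ?_
        · intro t ht
          simp only [hA, Finset.mem_filter, Finset.mem_univ, true_and] at ht ⊢
          exact (st τ (fx τ r)).mul_mem ht hs
        · intro t ht
          simp only [hA, Finset.mem_filter, Finset.mem_univ, true_and] at ht ⊢
          exact (st τ (fx τ r)).mul_mem ht ((st τ (fx τ r)).inv_mem hs)
        · intro t ht; simp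
        · intro t ht; simp
        · intro t ht
          change F (ρ t⁻¹ d) = F (ρ s (ρ (t * s)⁻¹ d))
          rw [mul_inv_rev, map_mul, Module.End.mul_apply, rep_cancel]
      have : ∑ t ∈ A, act τ t (P' (ρ t⁻¹ d)) =
          ∑ t ∈ A, P' (ρ t⁻¹ d) - ∑ t ∈ A, (P' (ρ t⁻¹ d) - act τ t (P' (ρ t⁻¹ d))) := by
        rw [Finset.sum_sub_distrib]; ring
      rw [this, h0, zero_sub, dvd_neg]
      apply Finset.dvd_sum
      intro t ht
      simp only [hA, Finset.mem_filter, Finset.mem_univ, true_and] at ht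
      exact dvd_sub_act hr ht _
    obtain ⟨z, hz⟩ := hdiv
    have hpd : a * pd y (F δ) = (e : Po N) * a ^ e * C (al τ r y) * P' d + a ^ (e + 1) * pd y (P' d) := by
      rw [hFδ, Derivation.leibniz, Derivation.leibniz_pow, pd_lin]
      obtain ⟨e', he'⟩ : ∃ e', e = e' + 1 :=
        Nat.exists_eq_succ_of_ne_zero (by rw [he, ee]; exact Nat.card_pos.ne')
      rw [he']
      simp only [smul_eq_mul, nsmul_eq_mul, Nat.add_sub_cancel]
      push_cast
      ring
    refine ⟨pd y (P' d) + C (al τ r y) * z, ?_⟩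
    apply mul_left_cancel₀ hprime.ne_zero
    change a * (pd y (F δ) - _) = _
    rw [mul_sub, hpd, mul_left_comm, hG, hz]
    ring

end KZ

namespace KZ
open MvPolynomial
open scoped Classical
set_option linter.unusedSectionVars false

variable {N n p : ℕ} {G : Type*} [Group G] [Fintype G]

/-- Irreducibility. -/
def Irr (ρ : Representation ℂ G (Vc n)) : Prop :=
  0 < n ∧ ∀ U : Submodule ℂ (Vc n), (∀ g : G, U.map (ρ g) ≤ U) → U = ⊥ ∨ U = ⊤

/-- Equivariant pairings with values in polynomials which solve the KZ type equation. -/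
structure Pairing (τ : Representation ℂ G (Vc N)) (ρX : Representation ℂ G (Vc p))
    (ρD : Representation ℂ G (Vc n)) (k : ℤ) (b : Vc p →ₗ[ℂ] Vc n →ₗ[ℂ] Po N) : Prop where
  ne : b ≠ 0
  equi : ∀ w x d, b (ρX w x) (ρD w d) = act τ w (b x d)
  ode : ∀ x d, ∃ Gt : G → Po N, (∀ t ∈ Rf τ, lin (al τ t) * Gt t = b x d - b (ρX t x) d) ∧
    ∀ y, pd y (b x d) = ∑ t ∈ Rf τ, C (al τ t y) * Gt t
  quasi : ∀ x, InQ τ ρD (b x)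
  hom : ∀ x d, Hom k (b x d)

variable {τ : Representation ℂ G (Vc N)} {ρ : Representation ℂ G (Vc n)}

theorem exists_degree (ρ : Representation ℂ G (Vc n)) (hn : 0 < n) :
    ∃ k : ℕ, ∃ F : Vc n →ₗ[ℂ] Po N, F ≠ 0 ∧ InQ τ ρ F ∧ ∀ d, Hom k (F d) := by
  let q : Po N := ∏ t ∈ Rf τ, lin (al τ t) ^ ee τ (fx τ t)
  let F : Vc n →ₗ[ℂ] Po N := (LinearMap.proj (⟨0, hn⟩ : Fin n)).smulRight q
  have hq : q ≠ 0 := Finset.prod_ne_zero_iff.2 fun t ht => pow_ne_zero _ (lin_ne_zero (al_ne_zero ht))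
  have hF : ∀ d, F d = C (d ⟨0, hn⟩) * q := by
    intro d; simp [F, MvPolynomial.smul_eq_C_mul]
  refine ⟨∑ t ∈ Rf τ, ee τ (fx τ t), F, ?_, ?_, ?_⟩
  · intro h
    have := congrArg (fun f => f (fun _ => 1)) h
    simp [hF, hq] at this
  · intro t ht s hs d
    rw [hF]
    exact (Finset.dvd_prod_of_mem _ ht).mul_left _
  · intro d
    rw [hF]
    apply Hom.C_mul
    have : Hom (∑ t ∈ Rf τ, ((ee τ (fx τ t) : ℕ) : ℤ) * 1) q :=
      Hom.prod fun t _ => (Hom.lin _).pow _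
    simpa using this

theorem Hom.act {k : ℤ} {q : Po N} (h : Hom k q) (w : G) : Hom k (act τ w q) := h.subst _

theorem exists_pairing (hτ : Function.Injective τ) (hρ : Irr ρ) :
    ∃ (p : ℕ) (ρX : Representation ℂ G (Vc p)) (k : ℤ) (b : Vc p →ₗ[ℂ] Vc n →ₗ[ℂ] Po N),
      Irr ρX ∧ Pairing τ ρX ρ k b := by
  have hex := exists_degree (τ := τ) ρ hρ.1
  set k := Nat.find hex with hk
  obtain ⟨F0, hF0, hF0Q, hF0h⟩ := Nat.find_spec hex
  have hmin : ∀ j : ℤ, j < k → ∀ F : Vc n →ₗ[ℂ] Po N, InQ τ ρ F → (∀ d, Hom j (F d)) → F = 0 := by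
    intro j hj F hQ hh
    by_contra hne
    rcases lt_or_ge j 0 with h0 | h0
    · exact hne (LinearMap.ext fun d => (hh d).eq_zero_of_neg h0)
    · obtain ⟨i, rfl⟩ := Int.eq_ofNat_of_zero_le h0
      exact Nat.find_min hex (m := i) (by omega) ⟨F, hne, hQ, hh⟩
  have hode : ∀ F : Vc n →ₗ[ℂ] Po N, InQ τ ρ F → (∀ d, Hom k (F d)) →
      ∃ Gt : G → (Vc n →ₗ[ℂ] Po N),
        (∀ t ∈ Rf τ, ∀ d, lin (al τ t) * Gt t d = F d - ho τ ρ t F d) ∧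
        ∀ y d, pd y (F d) = ∑ t ∈ Rf τ, C (al τ t y) * Gt t d := by
    intro F hQ hh
    obtain ⟨Gt, h1, h2⟩ := dunkl hτ hQ
    refine ⟨Gt, h1, fun y d => ?_⟩
    have h3 := hmin ((k : ℤ) - 1) (by omega) _ (h2 y) ?_
    · have h4 := congrArg (fun f => f d) h3
      simp only [LinearMap.sub_apply, LinearMap.comp_apply, LinearMap.sum_apply,
        LinearMap.smul_apply, LinearMap.zero_apply, sub_eq_zero, MvPolynomial.smul_eq_C_mul] at h4
      exact h4
    · intro d
      simp only [LinearMap.sub_apply, LinearMap.comp_apply, LinearMap.sum_apply,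
        LinearMap.smul_apply]
      refine Hom.sub ((hh d).pd y) (Hom.sum fun t ht => Hom.smul _ ?_)
      refine Hom.of_mul (lin_ne_zero (al_ne_zero ht)) (Hom.lin _) ?_
      rw [h1 t ht]
      exact (hh d).sub ((hh _).act t)
  have hexU : ∃ p : ℕ, ∃ U : Submodule ℂ (Vc n →ₗ[ℂ] Po N), FiniteDimensional ℂ U ∧
      Module.finrank ℂ U = p ∧ U ≠ ⊥ ∧ (∀ w, ∀ F ∈ U, ho τ ρ w F ∈ U) ∧
      ∀ F ∈ U, InQ τ ρ F ∧ ∀ d, Hom k (F d) := by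
    refine ⟨_, Submodule.span ℂ (Set.range fun w => ho τ ρ w F0),
      FiniteDimensional.span_of_finite ℂ (Set.finite_range _), rfl, ?_, ?_, ?_⟩
    · intro h
      rw [Submodule.span_eq_bot] at h
      have := h (ho τ ρ 1 F0) ⟨1, rfl⟩
      simp at this
      exact hF0 this
    · intro w F hF
      induction hF using Submodule.span_induction with
      | mem x hx =>
        obtain ⟨u, rfl⟩ := hx
        apply Submodule.subset_span
        exact ⟨w * u, by simp [map_mul]⟩
      | zero => simp
      | add x y _ _ hx hy => rw [map_add]; exact Submodule.add_mem _ hx hy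
      | smul c x _ hx => rw [map_smul]; exact Submodule.smul_mem _ _ hx
    · intro F hF
      induction hF using Submodule.span_induction with
      | mem x hx =>
        obtain ⟨u, rfl⟩ := hx
        exact ⟨hF0Q.ho u, fun d => (hF0h _).act u⟩
      | zero => exact ⟨InQ.zero, fun d => Hom.zero⟩
      | add x y _ _ hx hy => exact ⟨hx.1.add hy.1, fun d => (hx.2 d).add (hy.2 d)⟩
      | smul c x _ hx => exact ⟨hx.1.smul c, fun d => (hx.2 d).smul c⟩
  obtain ⟨U, hfin, hrk, hU0, hst, hUQ⟩ := Nat.find_spec hexU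
  set p := Nat.find hexU with hp
  haveI : Module.Free ℂ U := Module.Free.of_divisionRing ℂ U
  let e : U ≃ₗ[ℂ] Vc p := LinearEquiv.ofFinrankEq _ _ (by rw [hrk]; simp)
  let ρX : Representation ℂ G (Vc p) :=
    { toFun := fun w => e.toLinearMap ∘ₗ ((ho τ ρ w).restrict (hst w)) ∘ₗ e.symm.toLinearMap
      map_one' := by
        refine LinearMap.ext fun x => ?_
        apply e.symm.injective
        apply Subtype.ext
        simp
      map_mul' := by
        intro a c
        refine LinearMap.ext fun x => ?_
        apply e.symm.injective
        apply Subtype.ext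
        simp [map_mul] }
  have hρX : ∀ w x, (e.symm (ρX w x) : Vc n →ₗ[ℂ] Po N) = ho τ ρ w (e.symm x) := by
    intro w x
    simp [ρX]
  let b : Vc p →ₗ[ℂ] Vc n →ₗ[ℂ] Po N := U.subtype ∘ₗ e.symm.toLinearMap
  have hb : ∀ x, b x = (e.symm x : Vc n →ₗ[ℂ] Po N) := fun x => rfl
  refine ⟨p, ρX, k, b, ⟨?_, ?_⟩, ⟨?_, ?_, ?_, ?_, ?_⟩⟩
  · rw [Nat.pos_iff_ne_zero]
    intro h0
    rw [h0] at hrk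
    exact hU0 (Submodule.finrank_eq_zero.1 hrk)
  · intro T hT
    by_contra hcon
    push Not at hcon
    let T' : Submodule ℂ (Vc n →ₗ[ℂ] Po N) := T.map b
    have hbinj : Function.Injective b := fun x y h => e.symm.injective (Subtype.ext h)
    have hrT : Module.finrank ℂ T' = Module.finrank ℂ T :=
      (Submodule.equivMapOfInjective b hbinj T).finrank_eq.symm
    have hlt : Module.finrank ℂ T < p := by
      have := Submodule.finrank_lt hcon.2
      simpa using this
    refine Nat.find_min hexU hlt ⟨T', inferInstance, hrT, ?_, ?_, ?_⟩
    · intro h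
      rw [h, finrank_bot] at hrT
      exact hcon.1 (Submodule.finrank_eq_zero.1 hrT.symm)
    · rintro w F ⟨x, hx, rfl⟩
      refine ⟨ρX w x, hT w ⟨x, hx, rfl⟩, ?_⟩
      rw [hb, hb, hρX]
    · rintro F ⟨x, hx, rfl⟩
      exact hUQ _ (e.symm x).2
  · intro h
    apply hU0
    rw [eq_bot_iff]
    intro F hF
    have := congrArg (fun f => f (e ⟨F, hF⟩)) h
    simp [hb] at this
    simpa using this
  · intro w x d
    rw [hb, hb, hρX, ho_apply]
    congr 2
    rw [← Module.End.mul_apply, ← map_mul]; simp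
  · intro x d
    obtain ⟨Gt, h1, h2⟩ := hode _ (hUQ _ (e.symm x).2).1 (hUQ _ (e.symm x).2).2
    refine ⟨fun t => Gt t d, fun t ht => ?_, fun y => ?_⟩
    · rw [h1 t ht d, hb, hb, hρX]
    · rw [hb]; exact h2 y d
  · intro x; exact (hUQ _ (e.symm x).2).1
  · intro x d; exact (hUQ _ (e.symm x).2).2 d

/-- Uniqueness of solutions. -/
theorem ode_unique {ρX : Representation ℂ G (Vc p)} (f : Vc p →ₗ[ℂ] Po N)
    (hf : ∀ x, ∃ Gt : G → Po N, (∀ t ∈ Rf τ, lin (al τ t) * Gt t = f x - f (ρX t x)) ∧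
      ∀ y, pd y (f x) = ∑ t ∈ Rf τ, C (al τ t y) * Gt t)
    (v : Vc N) (hv : ∀ t ∈ Rf τ, al τ t v ≠ 0) (h0 : ∀ x, eval v (f x) = 0) : f = 0 := by
  refine LinearMap.ext fun x => ?_
  apply po_ext
  intro u
  set y := u - v with hy
  have key : ∀ k : ℕ, ∀ x, (Polynomial.X : Polynomial ℂ) ^ k ∣ ln v y (f x) := by
    intro k
    induction k with
    | zero => simp
    | succ k ih =>
      intro x
      obtain ⟨Gt, h1, h2⟩ := hf x
      have h3 : ∀ t ∈ Rf τ, (Polynomial.X : Polynomial ℂ) ^ k ∣ ln v y (Gt t) := by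
        intro t ht
        have h4 : (Polynomial.X : Polynomial ℂ) ^ k ∣ ln v y (lin (al τ t)) * ln v y (Gt t) := by
          rw [← map_mul, h1 t ht, map_sub]
          exact dvd_sub (ih _) (ih _)
        refine Polynomial.prime_X.pow_dvd_of_dvd_mul_left k ?_ h4
        rw [Polynomial.X_dvd_iff, Polynomial.coeff_zero_eq_eval_zero, eval_ln]
        simpa using hv t ht
      have h5 : (Polynomial.X : Polynomial ℂ) ^ k ∣ Polynomial.derivative (ln v y (f x)) := by
        rw [deriv_ln, h2, map_sum]
        apply Finset.dvd_sum
        intro t ht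
        rw [map_mul]
        exact (h3 t ht).mul_left _
      rw [Polynomial.X_pow_dvd_iff] at h5 ⊢
      intro i hi
      cases i with
      | zero =>
        rw [Polynomial.coeff_zero_eq_eval_zero, eval_ln]
        simpa using h0 x
      | succ i =>
        have := h5 i (by omega)
        rw [Polynomial.coeff_derivative] at this
        have h6 : (i : ℂ) + 1 ≠ 0 := by exact_mod_cast Nat.succ_ne_zero i
        exact (mul_eq_zero.1 this).resolve_right h6
  have hz : ln v y (f x) = 0 := by
    ext i
    have := Polynomial.X_pow_dvd_iff.1 (key (i + 1) x) i (by omega)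
    simpa using this
  have := congrArg (Polynomial.eval 1) hz
  rw [eval_ln] at this
  simpa [hy] using this

end KZ

namespace KZ
open MvPolynomial
open scoped Classical
set_option linter.unusedSectionVars false

variable {N n p : ℕ} {G : Type*} [Group G] [Fintype G]
variable {τ : Representation ℂ G (Vc N)} {ρX : Representation ℂ G (Vc p)}
  {ρ : Representation ℂ G (Vc n)} {k : ℤ} {b : Vc p →ₗ[ℂ] Vc n →ₗ[ℂ] Po N}

theorem rep_cancel' {m : ℕ} (ρ : Representation ℂ G (Vc m)) (w : G) (d : Vc m) :
    ρ w⁻¹ (ρ w d) = d := by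
  rw [← Module.End.mul_apply, ← map_mul]; simp

theorem Pairing.inj_left (h : Pairing τ ρX ρ k b) (hX : Irr ρX) : LinearMap.ker b = ⊥ := by
  have hstab : ∀ w, (LinearMap.ker b).map (ρX w) ≤ LinearMap.ker b := by
    rintro w _ ⟨x, hx, rfl⟩
    rw [LinearMap.mem_ker]
    refine LinearMap.ext fun d => ?_
    have h1 := h.equi w x (ρ w⁻¹ d)
    rw [rep_cancel] at h1
    rw [h1]
    have hx' : b x = 0 := hx
    simp [hx']
  rcases hX.2 (LinearMap.ker b) hstab with h1 | h1
  · exact h1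
  · exact absurd (LinearMap.ker_eq_top.1 h1) h.ne

theorem Pairing.inj_right (h : Pairing τ ρX ρ k b) (hX : Irr ρ) : LinearMap.ker b.flip = ⊥ := by
  have hstab : ∀ w, (LinearMap.ker b.flip).map (ρ w) ≤ LinearMap.ker b.flip := by
    rintro w _ ⟨d, hd, rfl⟩
    rw [LinearMap.mem_ker]
    refine LinearMap.ext fun x => ?_
    have h1 := h.equi w (ρX w⁻¹ x) d
    rw [rep_cancel] at h1
    rw [LinearMap.flip_apply, h1]
    have hx' : b.flip d = 0 := hd
    have := congrArg (fun f => f (ρX w⁻¹ x)) hx'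
    simp at this
    simp [this]
  rcases hX.2 (LinearMap.ker b.flip) hstab with h1 | h1
  · exact h1
  · exfalso
    apply h.ne
    have := LinearMap.ker_eq_top.1 h1
    refine LinearMap.ext fun x => LinearMap.ext fun d => ?_
    have := congrArg (fun f => f d x) this
    simpa using this

theorem Pairing.euler (h : Pairing τ ρX ρ k b) (hX : Irr ρX) (x : Vc p) :
    ∑ t ∈ Rf τ, (x - ρX t x) = (k : ℂ) • x := by
  rw [← sub_eq_zero, ← Submodule.mem_bot ℂ, ← h.inj_left hX, LinearMap.mem_ker]
  refine LinearMap.ext fun d => ?_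
  apply po_ext; intro v
  obtain ⟨Gt, h1, h2⟩ := h.ode x d
  have h3 := (h.hom x d).euler v
  rw [h2 v, map_sum] at h3
  simp only [map_sub, map_sum, map_smul, LinearMap.sub_apply, LinearMap.sum_apply,
    LinearMap.smul_apply, map_zero, LinearMap.zero_apply]
  rw [MvPolynomial.smul_eval, ← h3, sub_eq_zero]
  refine Finset.sum_congr rfl fun t ht => ?_
  have := congrArg (eval v) (h1 t ht)
  simp only [map_mul, eval_lin, map_sub, eval_C] at this ⊢
  exact this.symm

/-- The sum of `χ(1) - χ(t)` over reflections. -/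
def KK (τ : Representation ℂ G (Vc N)) (χ : G → ℂ) : ℂ := ∑ t ∈ Rf τ, (χ 1 - χ t)

theorem Pairing.KK_eq (h : Pairing τ ρX ρ k b) (hX : Irr ρX) :
    KK τ ρX.character = (k : ℂ) * p := by
  have h1 : ∑ t ∈ Rf τ, (ρX 1 - ρX t) = (k : ℂ) • LinearMap.id := by
    refine LinearMap.ext fun x => ?_
    have := h.euler hX x
    simpa [LinearMap.sum_apply] using this
  have h2 := congrArg (LinearMap.trace ℂ (Vc p)) h1
  rw [map_sum] at h2
  simp only [map_sub, map_smul] at h2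
  simp only [KK, Representation.character]
  rw [h2]
  simp

/-- Evaluation at a point as a linear map. -/
def evL (v : Vc N) : Po N →ₗ[ℂ] ℂ := (aeval v).toLinearMap

@[simp] theorem evL_apply (v : Vc N) (q : Po N) : evL v q = eval v q := by
  simp [evL]

/-- The evaluated pairing. -/
def evP (b : Vc p →ₗ[ℂ] Vc n →ₗ[ℂ] Po N) (v : Vc N) : Vc n →ₗ[ℂ] Vc p →ₗ[ℂ] ℂ :=
  b.flip.compr₂ (evL v)

@[simp] theorem evP_apply (v : Vc N) (d : Vc n) (x : Vc p) : evP b v d x = eval v (b x d) := by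
  simp [evP]

theorem Pairing.inj_evP (h : Pairing τ ρX ρ k b) (hD : Irr ρ) {v : Vc N}
    (hv : ∀ t ∈ Rf τ, al τ t v ≠ 0) : Function.Injective (evP b v) := by
  rw [← LinearMap.ker_eq_bot, eq_bot_iff]
  intro d hd
  rw [← h.inj_right hD, LinearMap.mem_ker]
  refine ode_unique (τ := τ) (ρX := ρX) (b.flip d) ?_ v hv ?_
  · intro x; exact h.ode x d
  · intro x
    have hd' : evP b v d = 0 := hd
    have := congrArg (fun f => f x) hd'
    simpa using this

theorem Pairing.dim_le (h : Pairing τ ρX ρ k b) (hD : Irr ρ) {v : Vc N}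
    (hv : ∀ t ∈ Rf τ, al τ t v ≠ 0) : n ≤ p := by
  have := LinearMap.finrank_le_finrank_of_injective (h.inj_evP hD hv)
  simpa [Module.finrank_linearMap] using this

/-- The evaluated pairing as an equivalence. -/
def Pairing.eqv (h : Pairing τ ρX ρ k b) (hD : Irr ρ) {v : Vc N}
    (hv : ∀ t ∈ Rf τ, al τ t v ≠ 0) (hnp : p = n) : Vc n ≃ₗ[ℂ] (Vc p →ₗ[ℂ] ℂ) :=
  LinearEquiv.ofInjectiveOfFinrankEq (evP b v) (h.inj_evP hD hv)
    (by simp [hnp])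

theorem Pairing.eqv_apply (h : Pairing τ ρX ρ k b) (hD : Irr ρ) {v : Vc N}
    (hv : ∀ t ∈ Rf τ, al τ t v ≠ 0) (hnp : p = n) (d : Vc n) :
    h.eqv hD hv hnp d = evP b v d := rfl

theorem Pairing.trace_eq (h : Pairing τ ρX ρ k b) (hD : Irr ρ) {v : Vc N}
    (hv : ∀ t ∈ Rf τ, al τ t v ≠ 0) (hnp : p = n) {g : G} {ζ : ℂ} (hζ : ζ ≠ 0)
    (hg : τ g v = ζ • v) : ζ ^ k * ρ.character g = ρX.character g⁻¹ := by
  have hgi : τ g⁻¹ v = ζ⁻¹ • v := by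
    have := congrArg (τ g⁻¹) hg
    rw [rep_cancel', map_smul] at this
    conv_rhs => rw [this]
    rw [smul_smul, inv_mul_cancel₀ hζ, one_smul]
  let e := h.eqv hD hv hnp
  have h1 : ζ ^ k • ρ g = e.symm.conj ((ρX g⁻¹).dualMap) := by
    refine LinearMap.ext fun d => ?_
    rw [LinearEquiv.conj_apply_apply]
    apply e.injective
    simp only [LinearEquiv.symm_symm, LinearEquiv.apply_symm_apply, LinearMap.smul_apply, map_smul]
    refine LinearMap.ext fun x => ?_
    simp only [e, LinearMap.smul_apply, Pairing.eqv_apply, evP_apply, LinearMap.dualMap_apply, smul_eq_mul]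
    have h2 := h.equi g (ρX g⁻¹ x) d
    rw [rep_cancel] at h2
    rw [h2, eval_act, hgi, h.hom _ _ _ (inv_ne_zero hζ), ← mul_assoc, inv_zpow,
      mul_inv_cancel₀ (zpow_ne_zero _ hζ), one_mul]
  have h2 := congrArg (LinearMap.trace ℂ (Vc n)) h1
  rw [map_smul, LinearMap.trace_conj'] at h2
  have h3 : LinearMap.trace ℂ (Vc p →ₗ[ℂ] ℂ) (ρX g⁻¹).dualMap = LinearMap.trace ℂ _ (ρX g⁻¹) :=
    LinearMap.trace_transpose' (ρX g⁻¹)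
  rw [h3] at h2
  exact h2

theorem Pairing.char_eq {n' : ℕ} {ρ' : Representation ℂ G (Vc n')} {k' : ℤ}
    {b' : Vc p →ₗ[ℂ] Vc n' →ₗ[ℂ] Po N}
    (h : Pairing τ ρX ρ k b) (h' : Pairing τ ρX ρ' k' b') (hD : Irr ρ) (hD' : Irr ρ') {v : Vc N}
    (hv : ∀ t ∈ Rf τ, al τ t v ≠ 0) (hnp : p = n) : ρ'.character = ρ.character := by
  let e := h.eqv hD hv hnp
  let Φ : Vc n' →ₗ[ℂ] Vc n := e.symm.toLinearMap ∘ₗ evP b' v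
  have hΦ : ∀ d x, eval v (b x (Φ d)) = eval v (b' x d) := by
    intro d x
    have h1 : e (Φ d) = evP b' v d := by simp [Φ]
    have := congrArg (fun f => f x) h1
    simpa [e, Pairing.eqv_apply] using this
  have hΦinj : Function.Injective Φ := e.symm.injective.comp (h'.inj_evP hD' hv)
  have hb : ∀ d x, b x (Φ d) = b' x d := by
    intro d x
    have h1 := ode_unique (τ := τ) (ρX := ρX) (b.flip (Φ d) - b'.flip d) ?_ v hv ?_
    · have := congrArg (fun f => f x) h1
      simpa [sub_eq_zero] using this
    · intro x
      obtain ⟨G1, h1, h2⟩ := h.ode x (Φ d)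
      obtain ⟨G2, h3, h4⟩ := h'.ode x d
      refine ⟨fun t => G1 t - G2 t, fun t ht => ?_, fun y => ?_⟩
      · rw [mul_sub, h1 t ht, h3 t ht]; simp; ring
      · simp only [LinearMap.sub_apply, LinearMap.flip_apply, map_sub, h2, h4, mul_sub,
          Finset.sum_sub_distrib]
    · intro x; simp [hΦ]
  have hinter : ∀ w d, Φ (ρ' w d) = ρ w (Φ d) := by
    intro w d
    have hk := h.inj_right hD
    rw [LinearMap.ker_eq_bot] at hk
    apply hk
    refine LinearMap.ext fun x => ?_
    simp only [LinearMap.flip_apply]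
    rw [hb]
    have h1 := h.equi w (ρX w⁻¹ x) (Φ d)
    have h2 := h'.equi w (ρX w⁻¹ x) d
    rw [rep_cancel] at h1 h2
    rw [h1, h2, hb]
  have hsurj : Function.Surjective Φ := by
    rw [← LinearMap.range_eq_top]
    have hstab : ∀ w, (LinearMap.range Φ).map (ρ w) ≤ LinearMap.range Φ := by
      rintro w _ ⟨_, ⟨d, rfl⟩, rfl⟩
      exact ⟨ρ' w d, hinter w d⟩
    rcases hD.2 (LinearMap.range Φ) hstab with h1 | h1
    · exfalso
      have h2 := LinearMap.range_eq_bot.1 h1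
      have h3 : (fun _ => 1 : Vc n') = 0 := hΦinj (by rw [h2]; simp)
      have := congrFun h3 ⟨0, hD'.1⟩
      simp at this
    · exact h1
  let E : Vc n' ≃ₗ[ℂ] Vc n := LinearEquiv.ofBijective Φ ⟨hΦinj, hsurj⟩
  funext w
  have h1 : ρ w = E.conj (ρ' w) := by
    refine LinearMap.ext fun d => ?_
    rw [LinearEquiv.conj_apply_apply]
    change _ = Φ _
    rw [hinter]
    change _ = ρ w (E (E.symm d))
    simp
  simp only [Representation.character]
  rw [h1, LinearMap.trace_conj']

end KZ

namespace KZ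
open MvPolynomial
open scoped Classical
set_option linter.unusedSectionVars false

variable {N n p : ℕ} {G : Type*} [Group G] [Fintype G]
variable {τ : Representation ℂ G (Vc N)} {ρ : Representation ℂ G (Vc n)}

theorem det_dvd (L : Fin n → (Vc n →ₗ[ℂ] Po N)) (U K : Submodule ℂ (Vc n)) (hUK : IsCompl U K)
    (a : Po N) (h : ∀ i, ∀ d ∈ K, a ∣ L i d) :
    a ^ Module.finrank ℂ K ∣ Matrix.det (Matrix.of fun i j => L i (Pi.single j 1)) := by
  let B0 : Module.Basis (Fin (Module.finrank ℂ U) ⊕ Fin (Module.finrank ℂ K)) ℂ (Vc n) :=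
    ((Module.finBasis ℂ U).prod (Module.finBasis ℂ K)).map (Submodule.prodEquivOfIsCompl U K hUK)
  have hcard : Fintype.card (Fin (Module.finrank ℂ U) ⊕ Fin (Module.finrank ℂ K)) =
      Fintype.card (Fin n) := by
    have := Submodule.finrank_add_eq_of_isCompl hUK
    simpa using this
  let σ := Fintype.equivOfCardEq hcard
  let B := B0.reindex σ
  have hBK : ∀ l, B (σ (Sum.inr l)) ∈ K := by
    intro l
    simp [B, B0]
  let v : Fin n → Po N := fun j => Sum.elim (fun _ => 1) (fun _ => a) (σ.symm j)
  have h1 : ∀ i j, v j ∣ L i (B j) := by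
    intro i j
    obtain ⟨l, rfl⟩ := σ.surjective j
    rcases l with l | l
    · simp [v]
    · simpa [v] using h i _ (hBK l)
  choose Q hQ using h1
  have hM : (Matrix.of fun i j => L i (Pi.single j 1)) =
      (Matrix.of fun i j => v j * Q i j) *
        (Matrix.of fun l j => C (B.repr (Pi.single j 1) l)) := by
    ext1 i j
    rw [Matrix.mul_apply]
    simp only [Matrix.of_apply]
    conv_lhs => rw [← B.sum_repr (Pi.single j 1), map_sum]
    refine Finset.sum_congr rfl fun l _ => ?_
    rw [map_smul, MvPolynomial.smul_eq_C_mul, hQ, mul_comm]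
  have hd : Matrix.det (Matrix.of fun i j => v j * Q i j) = (∏ i, v i) * Matrix.det (Matrix.of Q) :=
    Matrix.det_mul_row v (Matrix.of Q)
  rw [hM, Matrix.det_mul, hd]
  have hv : ∏ j, v j = a ^ Module.finrank ℂ K := by
    rw [← Equiv.prod_comp σ, Fintype.prod_sum_type]
    simp [v]
  rw [hv, mul_assoc]
  exact dvd_mul_right _ _

/-- Averaging over a subgroup. -/
theorem exists_avg (ρ : Representation ℂ G (Vc n)) (K : Subgroup G) :
    ∃ U Z : Submodule ℂ (Vc n), IsCompl U Z ∧
      ∑ s ∈ Finset.univ.filter (· ∈ K), (ρ.character 1 - ρ.character s) =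
        (Nat.card K : ℂ) * Module.finrank ℂ Z ∧
      ∀ d ∈ Z, (Nat.card K : ℂ) • d = ∑ s ∈ Finset.univ.filter (· ∈ K), (d - ρ s d) := by
  set A := Finset.univ.filter (· ∈ K) with hA
  have hc : A.card = Nat.card K := by
    rw [Nat.card_eq_fintype_card, Fintype.card_subtype]
  have hc0 : (Nat.card K : ℂ) ≠ 0 := by exact_mod_cast Nat.card_pos.ne'
  set T : Vc n →ₗ[ℂ] Vc n := ∑ s ∈ A, ρ s with hT
  have hsT : ∀ s ∈ A, ρ s * T = T := by
    intro s hs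
    rw [hT, Finset.mul_sum]
    simp only [hA, Finset.mem_filter, Finset.mem_univ, true_and] at hs
    refine Finset.sum_bij' (fun t _ => s * t) (fun t _ => s⁻¹ * t) ?_ ?_ ?_ ?_ ?_
    · intro t ht
      simp only [hA, Finset.mem_filter, Finset.mem_univ, true_and] at ht ⊢
      exact K.mul_mem hs ht
    · intro t ht
      simp only [hA, Finset.mem_filter, Finset.mem_univ, true_and] at ht ⊢
      exact K.mul_mem (K.inv_mem hs) ht
    · intro t ht; simp
    · intro t ht; simp
    · intro t ht; rw [map_mul]
  have hTT : T * T = (Nat.card K : ℂ) • T := by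
    conv_lhs => rw [hT]
    rw [← hT, Finset.sum_mul, Finset.sum_congr rfl hsT, Finset.sum_const, hc]
    rw [Nat.cast_smul_eq_nsmul]
  set ε : Vc n →ₗ[ℂ] Vc n := (Nat.card K : ℂ)⁻¹ • T with hε
  have hid : IsIdempotentElem ε := by
    rw [IsIdempotentElem, hε, smul_mul_smul_comm, hTT, smul_smul]
    congr 1
    field_simp
  refine ⟨LinearMap.range ε, LinearMap.ker ε, LinearMap.IsIdempotentElem.isCompl hid, ?_, ?_⟩
  · have h1 := (LinearMap.IsIdempotentElem.isProj_range ε hid).trace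
    have h2 := LinearMap.finrank_range_add_finrank_ker ε
    have h3 : LinearMap.trace ℂ _ ε = (Nat.card K : ℂ)⁻¹ * ∑ s ∈ A, ρ.character s := by
      rw [hε, map_smul, hT, map_sum]; rfl
    rw [h3] at h1
    have h4 : (Module.finrank ℂ (LinearMap.range ε) : ℂ) + Module.finrank ℂ (LinearMap.ker ε) = n := by
      have : Module.finrank ℂ (Vc n) = n := by simp
      rw [this] at h2
      exact_mod_cast h2
    have h5 : ρ.character 1 = n := by simp [Representation.character]
    rw [Finset.sum_sub_distrib, Finset.sum_const, hc, h5, nsmul_eq_mul]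
    have h6 : ∑ s ∈ A, ρ.character s = Nat.card K * Module.finrank ℂ (LinearMap.range ε) := by
      rw [← h1]; field_simp
    rw [h6, ← h4]; ring
  · intro d hd
    have hd' : ε d = 0 := hd
    have h1 : ∑ s ∈ A, ρ s d = 0 := by
      have : T d = 0 := by
        rw [hε, LinearMap.smul_apply, smul_eq_zero] at hd'
        exact hd'.resolve_left (inv_ne_zero hc0)
      rw [hT, LinearMap.sum_apply] at this
      exact this
    rw [Finset.sum_sub_distrib, h1, Finset.sum_const, hc, sub_zero, Nat.cast_smul_eq_nsmul]

theorem KK_hyper (hτ : Function.Injective τ) (χ : G → ℂ) : KK τ χ =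
    ∑ H ∈ (Rf τ).image (fx τ), ∑ s ∈ Finset.univ.filter (· ∈ st τ H), (χ 1 - χ s) := by
  rw [KK, ← Finset.sum_fiberwise_of_maps_to (t := (Rf τ).image (fx τ)) (g := fx τ)
    (fun t ht => Finset.mem_image_of_mem _ ht)]
  refine Finset.sum_congr rfl fun H hH => ?_
  obtain ⟨r, hr, rfl⟩ := Finset.mem_image.1 hH
  have : (Rf τ).filter (fun t => fx τ t = fx τ r) =
      (Finset.univ.filter (· ∈ st τ (fx τ r))).erase 1 := by
    ext t
    simp only [Finset.mem_filter, Finset.mem_erase, Finset.mem_univ, true_and]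
    constructor
    · rintro ⟨h1, h2⟩
      exact ⟨fun h => one_notMem_Rf (h ▸ h1), h2 ▸ self_mem_st t⟩
    · rintro ⟨h1, h2⟩
      exact ⟨mem_Rf_of_mem_st hτ hr h2 h1, fx_eq_of_mem_st hτ hr h2 h1⟩
  rw [this, Finset.sum_erase]
  simp

/-- The determinant inequality. -/
theorem Pairing.ineq {ρX : Representation ℂ G (Vc p)} {k : ℤ} {b : Vc p →ₗ[ℂ] Vc n →ₗ[ℂ] Po N}
    (hτ : Function.Injective τ)
    (h : Pairing τ ρX ρ k b) (hD : Irr ρ) {v : Vc N}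
    (hv : ∀ t ∈ Rf τ, al τ t v ≠ 0) (hnp : p = n) :
    ∃ κ : ℕ, KK τ ρ.character = κ ∧ (κ : ℤ) ≤ k * p := by
  subst hnp
  choose U Z hUZ hsum hZ using fun H => exists_avg ρ (st τ H)
  let κ := ∑ H ∈ (Rf τ).image (fx τ), ee τ H * Module.finrank ℂ (Z H)
  refine ⟨κ, ?_, ?_⟩
  · rw [KK_hyper hτ]
    push_cast [κ]
    refine Finset.sum_congr rfl fun H _ => ?_
    rw [hsum]; rfl
  · let M : Matrix (Fin p) (Fin p) (Po N) :=
      Matrix.of fun i j => b (Pi.single i 1) (Pi.single j 1)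
    have hdiv : ∀ H ∈ (Rf τ).image (fx τ), (lin (frm H) ^ ee τ H) ^ Module.finrank ℂ (Z H) ∣ M.det := by
      intro H hH
      obtain ⟨r, hr, rfl⟩ := Finset.mem_image.1 hH
      refine det_dvd (fun i => b (Pi.single i 1)) (U _) (Z _) (hUZ _) _ ?_
      intro i d hd
      have h1 := hZ _ d hd
      have hc0 : (Nat.card (st τ (fx τ r)) : ℂ) ≠ 0 := by exact_mod_cast Nat.card_pos.ne'
      have h2 : d = (Nat.card (st τ (fx τ r)) : ℂ)⁻¹ •
          ∑ s ∈ Finset.univ.filter (· ∈ st τ (fx τ r)), (d - ρ s d) := by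
        rw [← h1, smul_smul, inv_mul_cancel₀ hc0, one_smul]
      rw [h2, map_smul, MvPolynomial.smul_eq_C_mul]
      apply Dvd.dvd.mul_left
      rw [map_sum]
      apply Finset.dvd_sum
      intro s hs
      exact h.quasi _ r hr s (by simpa using hs) d
    have hprod : ∏ H ∈ (Rf τ).image (fx τ), (lin (frm H) ^ ee τ H) ^ Module.finrank ℂ (Z H) ∣ M.det := by
      apply Finset.prod_dvd_of_isRelPrime _ hdiv
      intro H hH H' hH' hne
      obtain ⟨r, hr, rfl⟩ := Finset.mem_image.1 (Finset.mem_coe.1 hH)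
      obtain ⟨r', hr', rfl⟩ := Finset.mem_image.1 (Finset.mem_coe.1 hH')
      have h1 : IsRelPrime (lin (frm (fx τ r))) (lin (frm (fx τ r'))) :=
        ((lin_prime (al_ne_zero hr)).irreducible.isRelPrime_iff_not_dvd).2
          (not_dvd_of_notMem hr hr' hne)
      exact ((h1.pow).pow)
    obtain ⟨q, hq⟩ := hprod
    have hdet0 : M.det ≠ 0 := by
      intro h0
      have h1 := congrArg (eval v) h0
      rw [RingHom.map_det, map_zero] at h1
      obtain ⟨w, hw0, hw⟩ := Matrix.exists_mulVec_eq_zero_iff.2 h1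
      apply hw0
      apply h.inj_evP hD hv
      rw [map_zero]
      refine LinearMap.pi_ext' fun i => LinearMap.ext_ring ?_
      have h2 := congrFun hw i
      simp only [Matrix.mulVec, dotProduct, RingHom.mapMatrix_apply, Matrix.map_apply, M,
        Matrix.of_apply, Pi.zero_apply] at h2
      simp only [LinearMap.comp_apply, LinearMap.single_apply, evP_apply, LinearMap.zero_apply]
      rw [← h2]
      conv_lhs => rw [← Finset.univ_sum_single w]
      rw [map_sum, map_sum]
      refine Finset.sum_congr rfl fun j _ => ?_
      have : (Pi.single j (w j) : Vc p) = w j • Pi.single j 1 := by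
        rw [← Pi.single_smul]; simp
      rw [this, map_smul, MvPolynomial.smul_eval, mul_comm]
    have hhom : Hom (k * p) M.det := by
      intro c hc u
      rw [RingHom.map_det, RingHom.map_det]
      have : (eval (c • u)).mapMatrix M = (c ^ k) • (eval u).mapMatrix M := by
        ext i j
        simp only [RingHom.mapMatrix_apply, Matrix.map_apply, M, Matrix.of_apply,
          Matrix.smul_apply, smul_eq_mul]
        exact h.hom _ _ c hc u
      rw [this, Matrix.det_smul, Fintype.card_fin, zpow_mul, zpow_natCast]
    have hhomp : Hom (κ : ℤ) (∏ H ∈ (Rf τ).image (fx τ),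
        (lin (frm H) ^ ee τ H) ^ Module.finrank ℂ (Z H) : Po N) := by
      have h1 : Hom (∑ H ∈ (Rf τ).image (fx τ), ((Module.finrank ℂ (Z H) : ℤ) * ((ee τ H : ℤ) * 1)))
          (∏ H ∈ (Rf τ).image (fx τ), (lin (frm H) ^ ee τ H) ^ Module.finrank ℂ (Z H) : Po N) :=
        Hom.prod fun H _ => ((Hom.lin _).pow _).pow _
      have h2 : (κ : ℤ) = ∑ H ∈ (Rf τ).image (fx τ),
          ((Module.finrank ℂ (Z H) : ℤ) * ((ee τ H : ℤ) * 1)) := by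
        push_cast [κ]
        exact Finset.sum_congr rfl fun H _ => by ring
      rw [h2]; exact h1
    by_contra hlt
    push Not at hlt
    have hprod0 : (∏ H ∈ (Rf τ).image (fx τ),
        (lin (frm H) ^ ee τ H) ^ Module.finrank ℂ (Z H) : Po N) ≠ 0 := by
      intro h0; rw [h0, zero_mul] at hq; exact hdet0 hq
    rw [hq] at hhom
    have hq0 := (Hom.of_mul hprod0 hhomp hhom).eq_zero_of_neg (by omega)
    rw [hq0, mul_zero] at hq
    exact hdet0 hq

end KZ

namespace KZ
open MvPolynomial
open scoped Classical
set_option linter.unusedSectionVars false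

variable {N n p q : ℕ} {G : Type*} [Group G] [Fintype G]
variable {τ : Representation ℂ G (Vc N)} {ρ : Representation ℂ G (Vc n)}

theorem Irr.isIrreducible (h : Irr ρ) : Representation.IsIrreducible ρ := by
  have hn : (⊥ : Submodule ℂ (Vc n)) ≠ ⊤ := by
    have : Nonempty (Fin n) := ⟨⟨0, h.1⟩⟩
    exact bot_ne_top
  refine { exists_pair_ne := ⟨⊥, ⊤, ?_⟩, eq_bot_or_eq_top := ?_ }
  · intro he
    exact hn (congrArg Subrepresentation.toSubmodule he)
  · intro U
    have hstab : ∀ g, U.toSubmodule.map (ρ g) ≤ U.toSubmodule := by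
      intro g
      rw [Submodule.map_le_iff_le_comap]
      intro x hx
      exact U.apply_mem_toSubmodule g hx
    rcases h.2 _ hstab with h1 | h1
    · left; exact Subrepresentation.toSubmodule_injective h1
    · right; exact Subrepresentation.toSubmodule_injective h1

theorem equiv_of_char {σ : Representation ℂ G (Vc p)} (h : Irr ρ) (h' : Irr σ)
    (hc : ρ.character = σ.character) :
    ∃ θ : Vc n ≃ₗ[ℂ] Vc p, ∀ w x, θ (ρ w x) = σ w (θ x) := by
  have := h.isIrreducible
  have := h'.isIrreducible
  have : Invertible (Nat.card G : ℂ) := invertibleOfNonzero (by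
    exact_mod_cast Nat.card_pos.ne')
  have h1 := Representation.char_orthonormal σ ρ
  have h2 := Representation.char_orthonormal ρ ρ
  rw [if_pos ⟨Representation.Equiv.refl ρ⟩] at h2
  rw [← hc, h2] at h1
  by_cases hne : Nonempty (Representation.Equiv ρ σ)
  · obtain ⟨φ⟩ := hne
    exact ⟨φ.toLinearEquiv, fun w x => by
      have := φ.toIntertwiningMap.isIntertwining' w
      exact LinearMap.congr_fun this x⟩
  · rw [if_neg hne] at h1
    norm_num at h1

theorem Pairing.transport {ρX : Representation ℂ G (Vc p)} {ρX' : Representation ℂ G (Vc q)}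
    {k : ℤ} {b : Vc p →ₗ[ℂ] Vc n →ₗ[ℂ] Po N} (h : Pairing τ ρX ρ k b)
    (θ : Vc q ≃ₗ[ℂ] Vc p) (hθ : ∀ w x, θ (ρX' w x) = ρX w (θ x)) :
    Pairing τ ρX' ρ k (b ∘ₗ θ.toLinearMap) := by
  refine ⟨?_, ?_, ?_, ?_, ?_⟩
  · intro h0
    apply h.ne
    refine LinearMap.ext fun x => ?_
    have := LinearMap.congr_fun h0 (θ.symm x)
    simpa using this
  · intro w x d
    simp [hθ, h.equi]
  · intro x d
    have := h.ode (θ x) d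
    simpa [hθ] using this
  · intro x
    exact h.quasi (θ x)
  · intro x d
    exact h.hom (θ x) d

theorem irr_dual (h : Irr ρ) : ∃ σ : Representation ℂ G (Vc n), Irr σ ∧
    ∀ w, σ.character w = ρ.character w⁻¹ := by
  let E : Module.Dual ℂ (Vc n) ≃ₗ[ℂ] Vc n := LinearEquiv.ofFinrankEq _ _ (by
    rw [Subspace.dual_finrank_eq])
  let σ : Representation ℂ G (Vc n) :=
    { toFun := fun w => E.conj (ρ.dual w)
      map_one' := by rw [map_one]; exact LinearEquiv.conj_id E
      map_mul' := by
        intro a b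
        rw [map_mul]
        exact LinearEquiv.conj_comp E _ _ }
  have hσ : ∀ w, σ w = E.conj (ρ.dual w) := fun _ => rfl
  refine ⟨σ, ⟨h.1, ?_⟩, ?_⟩
  · intro U hU
    let U' : Submodule ℂ (Module.Dual ℂ (Vc n)) := U.comap E.toLinearMap
    have hU' : ∀ w, ∀ f ∈ U', ρ.dual w f ∈ U' := by
      intro w f hf
      have := hU w (Submodule.mem_map_of_mem (show E f ∈ U from hf))
      rw [hσ, LinearEquiv.conj_apply] at this
      simpa [U'] using this
    have hstab : ∀ w, U'.dualCoannihilator.map (ρ w) ≤ U'.dualCoannihilator := by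
      intro w
      rw [Submodule.map_le_iff_le_comap]
      intro x hx
      rw [Submodule.mem_comap, Submodule.mem_dualCoannihilator]
      intro f hf
      rw [Submodule.mem_dualCoannihilator] at hx
      have := hx _ (hU' w⁻¹ f hf)
      rw [Representation.dual_apply, inv_inv] at this
      exact this
    have hUU : U'.dualCoannihilator.dualAnnihilator = U' :=
      Subspace.dualCoannihilator_dualAnnihilator_eq
    have hUm : U = U'.map E.toLinearMap := by
      rw [Submodule.map_comap_eq_of_surjective E.surjective]
    rcases h.2 _ hstab with h1 | h1
    · right
      rw [h1, Submodule.dualAnnihilator_bot] at hUU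
      rw [hUm, ← hUU, Submodule.map_top, LinearMap.range_eq_top.2 E.surjective]
    · left
      rw [h1, Submodule.dualAnnihilator_top] at hUU
      rw [hUm, ← hUU, Submodule.map_bot]
  · intro w
    rw [← Representation.char_dual]
    simp only [Representation.character, hσ, LinearMap.trace_conj']

theorem periodic_mono {α : Type*} {f : α → α} {a : α} {u : α → ℕ} (hu : ∀ a, u a ≤ u (f a))
    (ha : a ∈ Function.periodicPts f) : u (f a) = u a := by
  obtain ⟨k, hk, hp⟩ := ha
  refine le_antisymm ?_ (hu a)
  have key : ∀ j a, u a ≤ u (f^[j] a) := by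
    intro j
    induction j with
    | zero => intro a; exact le_rfl
    | succ j ih => intro a; exact (hu a).trans (ih (f a))
  obtain ⟨j, rfl⟩ : ∃ j, k = j + 1 := ⟨k - 1, by omega⟩
  have := key j (f a)
  rwa [← Function.iterate_succ_apply, hp.eq] at this

theorem all_periodic {α : Type*} [Finite α] {f : α → α} {u : α → ℕ} (hu : ∀ a, u a ≤ u (f a))
    (hf : ∀ a b, u (f a) = u a → f a = f b → b = a) (a : α) : a ∈ Function.periodicPts f := by
  have step : ∀ b, f b ∈ Function.periodicPts f → b ∈ Function.periodicPts f := by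
    intro b hb
    have hb' := hb
    obtain ⟨k, hk, hp⟩ := hb
    obtain ⟨j, rfl⟩ : ∃ j, k = j + 1 := ⟨k - 1, by omega⟩
    have hc : f^[j] (f b) ∈ Function.periodicPts f :=
      ⟨j + 1, hk, hp.apply_iterate j⟩
    have := hf _ b (periodic_mono hu hc) (by
      rw [← Function.iterate_succ_apply' f j]; exact hp.eq)
    rwa [← this] at hc
  have back : ∀ j a, f^[j] a ∈ Function.periodicPts f → a ∈ Function.periodicPts f := by
    intro j
    induction j with
    | zero => intro a h; exact h
    | succ j ih => intro a h; exact step _ (ih (f a) h)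
  obtain ⟨i, j, hij, he⟩ := Finite.exists_ne_map_eq_of_infinite (fun k : ℕ => f^[k] a)
  wlog hlt : i < j generalizing i j
  · exact this j i hij.symm he.symm (by omega)
  apply back i
  refine ⟨j - i, by omega, ?_⟩
  change f^[j-i] (f^[i] a) = f^[i] a
  rw [← Function.iterate_add_apply, Nat.sub_add_cancel hlt.le]
  exact he.symm

end KZ

namespace KZ
open MvPolynomial
open scoped Classical
set_option linter.unusedSectionVars false

variable {N : ℕ} {G : Type*} [Group G] [Fintype G]
variable {τ : Representation ℂ G (Vc N)}

/-- `χ` is the character of an irreducible representation on some `ℂ^n`. -/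
def IC (χ : G → ℂ) : Prop :=
  ∃ (n : ℕ) (ρ : Representation ℂ G (Vc n)), Irr ρ ∧ χ = ρ.character

theorem exists_perm (hτ : Function.Injective τ) [Finite {χ : G → ℂ // IC χ}] {v : Vc N}
    (hv : ∀ t ∈ Rf τ, al τ t v ≠ 0) {g : G} {ζ : ℂ} (hζ : ζ ≠ 0) (hg : τ g v = ζ • v) :
    ∃ f : {χ : G → ℂ // IC χ} → {χ : G → ℂ // IC χ}, Function.Injective f ∧
      ∀ a, (f a).1 1 = a.1 1 ∧ KK τ (f a).1 = KK τ a.1 ∧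
        ∀ m : ℤ, KK τ a.1 = m * a.1 1 → ζ ^ m * a.1 g = (f a).1 g⁻¹ := by
  choose nn rr hI hchar using fun a : {χ : G → ℂ // IC χ} => a.2
  choose pp rX kk bb hX hP using fun a : {χ : G → ℂ // IC χ} => exists_pairing hτ (hI a)
  let f : {χ : G → ℂ // IC χ} → {χ : G → ℂ // IC χ} :=
    fun a => ⟨(rX a).character, pp a, rX a, hX a, rfl⟩
  have hf1 : ∀ a, (f a).1 = (rX a).character := fun _ => rfl
  have hn1 : ∀ a, a.1 1 = (nn a : ℂ) := by
    intro a
    rw [hchar a, Representation.char_one]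
    simp
  have hp1 : ∀ a, (f a).1 1 = (pp a : ℂ) := by
    intro a
    rw [hf1 a, Representation.char_one]
    simp
  have hnf : ∀ a, nn (f a) = pp a := by
    intro a
    have := (hn1 (f a)).symm.trans (hp1 a)
    exact_mod_cast this
  have hu : ∀ a, nn a ≤ nn (f a) := fun a => by
    rw [hnf]; exact (hP a).dim_le (hI a) hv
  have hf : ∀ a b, nn (f a) = nn a → f a = f b → b = a := by
    intro a b h1 h2
    rw [hnf] at h1
    have h3 : (rX a).character = (rX b).character := congrArg Subtype.val h2
    obtain ⟨θ, hθ⟩ := equiv_of_char (hX a) (hX b) h3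
    have h4 := (hP a).char_eq ((hP b).transport θ hθ) (hI a) (hI b) hv h1
    apply Subtype.ext
    rw [hchar a, hchar b, h4]
  have hper : ∀ a, a ∈ Function.periodicPts f := all_periodic hu hf
  have hnp : ∀ a, pp a = nn a := fun a => by rw [← hnf]; exact periodic_mono hu (hper a)
  have hinj : Function.Injective f := by
    intro a b hab
    exact (hf a b (periodic_mono hu (hper a)) hab).symm
  choose κ hκ hκ2 using fun a => (hP a).ineq hτ (hI a) hv (hnp a)
  have hKf : ∀ a, KK τ (f a).1 = (kk a : ℂ) * pp a := fun a => (hP a).KK_eq (hX a)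
  have hKκ : ∀ a, KK τ a.1 = (κ a : ℂ) := fun a => by rw [hchar a]; exact hκ a
  have hmono : ∀ a, κ a ≤ κ (f a) := by
    intro a
    have h1 : (κ (f a) : ℂ) = (kk a : ℂ) * pp a := by rw [← hKκ, hKf]
    have h2 : (κ (f a) : ℤ) = kk a * pp a := by exact_mod_cast h1
    have := hκ2 a
    rw [← h2] at this
    exact_mod_cast this
  have hKK : ∀ a, KK τ (f a).1 = KK τ a.1 := by
    intro a
    rw [hKκ, hKκ, periodic_mono hmono (hper a)]
  refine ⟨f, hinj, fun a => ⟨?_, hKK a, ?_⟩⟩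
  · rw [hp1, hn1, hnp]
  · intro m hm
    have hk : kk a = m := by
      rw [← hKK, hKf, hn1, hnp] at hm
      have h0 : (nn a : ℂ) ≠ 0 := by exact_mod_cast (hI a).1.ne'
      exact_mod_cast mul_right_cancel₀ h0 hm
    have := (hP a).trace_eq (hI a) hv (hnp a) hζ hg
    rw [hk] at this
    rw [hf1, ← this, hchar a]

theorem KK_dual {χ χ' : G → ℂ} (h : ∀ w, χ' w = χ w⁻¹) : KK τ χ' = KK τ χ := by
  unfold KK
  refine Finset.sum_bij (fun t _ => t⁻¹) (fun t ht => inv_mem_Rf ht) ?_ ?_ ?_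
  · intro a _ b _ hab; exact inv_injective hab
  · intro b hb; exact ⟨b⁻¹, inv_mem_Rf hb, inv_inv b⟩
  · intro t _; rw [h, h, inv_one]

theorem core (hτ : Function.Injective τ) {v : Vc N}
    (hv : ∀ t ∈ Rf τ, al τ t v ≠ 0) {g : G} {ζ : ℂ} (hζ : ζ ≠ 0) (hg : τ g v = ζ • v)
    (m : ℤ) (hm : ζ ^ m ≠ 1) (S : Finset (G → ℂ)) (hS : ∀ χ, χ ∈ S ↔ IC χ) :
    ∑ χ ∈ S.filter (fun χ => KK τ χ = (m : ℂ) * χ 1), χ 1 * χ g⁻¹ = 0 := by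
  set T := S.filter (fun χ => KK τ χ = (m : ℂ) * χ 1) with hT
  have hTm : ∀ χ, χ ∈ T ↔ IC χ ∧ KK τ χ = (m : ℂ) * χ 1 := by
    intro χ; rw [hT, Finset.mem_filter, hS]
  have hfin : Finite {χ : G → ℂ // IC χ} :=
    Set.Finite.to_subtype (s := {χ | IC χ}) (S.finite_toSet.subset fun χ h => (hS χ).2 h)
  obtain ⟨f, hfi, hf⟩ := exists_perm hτ hv hζ hg
  have hsurj := Finite.surjective_of_injective hfi
  have h1 : ζ ^ m * ∑ χ ∈ T, χ 1 * χ g = ∑ χ ∈ T, χ 1 * χ g⁻¹ := by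
    rw [Finset.mul_sum]
    refine Finset.sum_bij (fun χ h => (f ⟨χ, ((hTm χ).1 h).1⟩).1) ?_ ?_ ?_ ?_
    · intro χ h
      rw [hTm]
      refine ⟨(f _).2, ?_⟩
      rw [(hf _).2.1, (hf _).1]
      exact ((hTm χ).1 h).2
    · intro χ h χ' h' he
      exact congrArg Subtype.val (hfi (Subtype.ext he))
    · intro χ h
      obtain ⟨⟨a, ha⟩, hfa⟩ := hsurj ⟨χ, ((hTm χ).1 h).1⟩
      have hχ : (f ⟨a, ha⟩).1 = χ := congrArg Subtype.val hfa
      refine ⟨a, ?_, hχ⟩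
      rw [hTm]
      refine ⟨ha, ?_⟩
      have h2 := ((hTm χ).1 h).2
      rw [← hχ, (hf _).2.1, (hf _).1] at h2
      exact h2
    · intro χ h
      rw [← (hf _).2.2 m ((hTm χ).1 h).2, (hf _).1]
      ring
  have hd : ∀ χ ∈ T, (fun w => χ w⁻¹) ∈ T := by
    intro χ h
    obtain ⟨⟨n, ρ, hρ, rfl⟩, hK⟩ := (hTm χ).1 h
    obtain ⟨σ, hσ, hσc⟩ := irr_dual hρ
    rw [hTm]
    refine ⟨⟨n, σ, hσ, (funext hσc).symm⟩, ?_⟩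
    rw [KK_dual (χ := ρ.character) (fun w => rfl), hK, inv_one]
  have h2 : ∑ χ ∈ T, χ 1 * χ g = ∑ χ ∈ T, χ 1 * χ g⁻¹ := by
    refine Finset.sum_bij (fun χ _ => fun w => χ w⁻¹) hd ?_ ?_ ?_
    · intro χ _ χ' _ he
      funext w
      have := congrFun he w⁻¹
      simpa using this
    · intro χ h
      exact ⟨_, hd χ h, by funext w; simp⟩
    · intro χ _
      simp
  rw [h2] at h1
  have h3 : (ζ ^ m - 1) * ∑ χ ∈ T, χ 1 * χ g⁻¹ = 0 := by rw [sub_mul, h1]; ring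
  exact (mul_eq_zero.1 h3).resolve_left (sub_ne_zero.2 hm)

end KZ

open Classical in
/-- If `W` is an irreducible complex reflection group and `g ∈ W` a regular element
of order `d`, then for every integer `m` not divisible by `d`, the sum of
`χ(1)·χ(g⁻¹)` over all irreducible characters `χ` with Coxeter number `c_χ = m`
vanishes. (`c_χ = m` is expressed by `Σ_{t ∈ R} (χ(1) − χ(t)) = m·χ(1)`.) -/
theorem coxeter_number_cancellation
    (V : Type*) [AddCommGroup V] [Module ℂ V] [FiniteDimensional ℂ V]
    (W : Subgroup (V →ₗ[ℂ] V)ˣ) [Finite W]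
    (hgen : Subgroup.closure (refls W) = ⊤)
    (hirr : IsIrredAction W)
    (d : ℕ) (g : W) (hg : IsRegularElt W g d)
    (m : ℤ) (hm : ¬ (d : ℤ) ∣ m)
    (S : Finset (W → ℂ)) (hS : ∀ χ : W → ℂ, χ ∈ S ↔ IsIrredChar W χ) :
    ∑ χ ∈ S.filter (fun χ => ∑ᶠ t ∈ refls W, (χ 1 - χ t) = (m : ℂ) * χ 1),
      χ 1 * χ g⁻¹ = 0 := by
  have := Fintype.ofFinite W
  obtain ⟨hord, ζ, v, hv0, hζ, hgv, hreg⟩ := hg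
  let e : V ≃ₗ[ℂ] KZ.Vc (Module.finrank ℂ V) :=
    LinearEquiv.ofFinrankEq _ _ (by simp)
  let τ : Representation ℂ W (KZ.Vc (Module.finrank ℂ V)) :=
    { toFun := fun w => e.conj (toLin W w)
      map_one' := LinearEquiv.conj_id e
      map_mul' := fun a b => LinearEquiv.conj_comp e (toLin W b) (toLin W a) }
  have hτ : ∀ w x, τ w (e x) = e (toLin W w x) := by
    intro w x
    change e.conj (toLin W w) (e x) = _
    rw [LinearEquiv.conj_apply]
    simp
  have hinj : Function.Injective τ := by
    intro a b hab
    have h1 : toLin W a = toLin W b := e.conj.injective hab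
    exact Subtype.ext (Units.ext h1)
  have hfx : ∀ t : W, KZ.fx τ t = (fixedSpace (t : (V →ₗ[ℂ] V)ˣ)).map e.toLinearMap := by
    intro t
    ext y
    obtain ⟨x, rfl⟩ := e.surjective y
    rw [KZ.mem_fx, hτ, e.injective.eq_iff]
    constructor
    · intro h
      refine ⟨x, ?_, rfl⟩
      change ((t : (V →ₗ[ℂ] V)ˣ) : V →ₗ[ℂ] V) x - x = 0
      exact sub_eq_zero.2 h
    · rintro ⟨x', hx', he⟩
      have : x' = x := e.injective he
      subst this
      have h2 : ((t : (V →ₗ[ℂ] V)ˣ) : V →ₗ[ℂ] V) x' - x' = 0 := hx'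
      exact sub_eq_zero.1 h2
  have hR : ∀ t : W, t ∈ KZ.Rf τ ↔ t ∈ refls W := by
    intro t
    have h1 : Module.finrank ℂ (KZ.fx τ t) =
        Module.finrank ℂ (fixedSpace (t : (V →ₗ[ℂ] V)ˣ)) := by
      rw [hfx]
      exact LinearEquiv.finrank_map_eq e _
    unfold KZ.Rf
    rw [Finset.mem_filter, h1]
    exact ⟨fun h => h.2, fun h => ⟨Finset.mem_univ _, h⟩⟩
  have hv : ∀ t ∈ KZ.Rf τ, KZ.al τ t (e v) ≠ 0 := by
    intro t ht h0
    have h1 := (KZ.al_eq_zero ht).1 h0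
    rw [← KZ.mem_fx, hfx] at h1
    obtain ⟨x', hx', he⟩ := h1
    have : x' = v := e.injective he
    subst this
    exact hreg _ ⟨t, (hR t).1 ht, rfl⟩ hx'
  have hd : d ≠ 0 := by
    rw [← hord]
    exact (orderOf_pos g).ne'
  have hζ0 : ζ ≠ 0 := hζ.ne_zero hd
  have hζm : ζ ^ m ≠ 1 := fun h => hm ((hζ.zpow_eq_one_iff_dvd m).1 h)
  have hgv' : τ g (e v) = ζ • e v := by
    rw [hτ, hgv, map_smul]
  have hS' : ∀ χ : W → ℂ, χ ∈ S ↔ KZ.IC χ := by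
    intro χ
    rw [hS]
    constructor
    · rintro ⟨n, ρ, h1, h2, h3⟩
      exact ⟨n, ρ, ⟨h1, h2⟩, funext h3⟩
    · rintro ⟨n, ρ, ⟨h1, h2⟩, rfl⟩
      exact ⟨n, ρ, h1, h2, fun _ => rfl⟩
  have hK : ∀ χ : W → ℂ, ∑ᶠ t ∈ refls W, (χ 1 - χ t) = KZ.KK τ χ := by
    intro χ
    have : refls W = (KZ.Rf τ : Set W) := by
      ext t
      rw [Finset.mem_coe, hR]
    rw [this, finsum_mem_coe_finset]
    rfl
  have hfinal := KZ.core hinj hv hζ0 hgv' m hζm S hS'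
  simp only [hK]
  convert hfinal
end
end
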